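/- arXiv:1802.01091 — 4 statements merged into one kernel-verified Lean document; each statement's English description precedes it below -/
import Mathlib

section
/- Let r ≥ 2 and t ≥ s ≥ 1 be integers with t < s + 1/2 + √(2s + 1/4). Then there exists n₀ such that for all n ≥ n₀ and all integers d with 0 ≤ d ≤ n−1: if F_{r,s,t}(⌊(r−1)n/r⌋, n) ≤ F_{r,s,t}(d, n), then d ≥ ⌊(r−1)n/r⌋. -/
open SimpleGraph

/-- The number of copies of `T` in `G`, i.e. the number of subgraphs of `G` isomorphic to `T`. -/
noncomputable def copies {α β : Type*} (T : SimpleGraph α) (G : SimpleGraph β) : ℕ :=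
  Nat.card {H : G.Subgraph // Nonempty (H.coe ≃g T)}

/-- `G` contains no subgraph isomorphic to `T`. -/
def Free {α β : Type*} (T : SimpleGraph α) (G : SimpleGraph β) : Prop :=
  ∀ H : G.Subgraph, ¬ Nonempty (H.coe ≃g T)

/-- `K^{(r)}_{s,t}`: the complete `r`-partite graph with one part of size `t`
and the other `r-1` parts of size `s`. -/
noncomputable def Kmulti (r s t : ℕ) :
    SimpleGraph (Σ i : Fin r, Fin (if (i : ℕ) = 0 then t else s)) :=
  completeMultipartiteGraph _

/-- `F_{r,s,t}(a, n) = λ_{s,t}·[ C(n−1−a, s−1)·N(T_{r−1}(a), K^{(r−1)}_{s,t})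
      + C(n−1−a, t−1)·N(T_{r−1}(a), K^{(r−1)}_{s,s}) ]`. -/
noncomputable def Fval (r s t a n : ℕ) : ℝ :=
  (if s = t then (1 / 2 : ℝ) else 1) *
    (((n - 1 - a).choose (s - 1) : ℝ) * (copies (Kmulti (r - 1) s t) (turanGraph a (r - 1)) : ℝ)
      + ((n - 1 - a).choose (t - 1) : ℝ) * (copies (Kmulti (r - 1) s s) (turanGraph a (r - 1)) : ℝ))

/-- The continuous form of the increment inequality. -/
lemma gap_pos (p w : ℕ) (hpw : p ≤ w) (hk : (w - p) ^ 2 < p + w + 2) (z : ℝ) (hz : 1 ≤ z) :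
    0 < ((p : ℝ) + 1) * ((w + 1) * z - p) - (w + 1) * z ^ (w - p) * (w - (p + 1) * z) := by
  obtain ⟨k, rfl⟩ := Nat.exists_eq_add_of_le hpw
  have hk' : (k : ℝ) ^ 2 < p + (p + k) + 2 := by
    have : k ^ 2 < p + (p + k) + 2 := by simpa using hk
    exact_mod_cast this
  rw [Nat.add_sub_cancel_left]
  push_cast
  have hp : (0 : ℝ) ≤ p := p.cast_nonneg
  have hk0 : (0 : ℝ) ≤ k := k.cast_nonneg
  have hα : ∀ x : ℝ, 1 ≤ x → 0 < ((p : ℝ) + k + 1) * x - p := fun x hx ↦ by nlinarith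
  rcases le_or_gt ((p : ℝ) + k - (p + 1) * z) 0 with h | h
  · have h1 := mul_pos (by positivity : (0 : ℝ) < p + 1) (hα z hz)
    have h2 : 0 ≤ ((p : ℝ) + k + 1) * z ^ k := by positivity
    nlinarith
  have hβ : ∀ x ∈ Set.Icc 1 z, 0 < (p : ℝ) + k - (p + 1) * x := fun x hx ↦ by
    nlinarith [hx.2]
  set φ : ℝ → ℝ := fun x ↦ Real.log ((p + k + 1) * x - p) - Real.log (p + k - (p + 1) * x)
    - k * Real.log x
  have hd : ∀ x ∈ Set.Icc 1 z, HasDerivAt φ ((p + k + 1) / ((p + k + 1) * x - p)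
      - (-(p + 1)) / (p + k - (p + 1) * x) - k * x⁻¹) x := fun x hx ↦ by
    have h1 : HasDerivAt (fun x : ℝ ↦ ((p : ℝ) + k + 1) * x - p) (p + k + 1) x := by
      simpa using ((hasDerivAt_id x).const_mul ((p : ℝ) + k + 1)).sub_const (p : ℝ)
    have h2 : HasDerivAt (fun x : ℝ ↦ (p : ℝ) + k - (p + 1) * x) (-(p + 1)) x := by
      simpa using ((hasDerivAt_id x).const_mul ((p : ℝ) + 1)).const_sub ((p : ℝ) + k)
    exact ((h1.log (hα x hx.1).ne').sub (h2.log (hβ x hx).ne')).sub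
      ((Real.hasDerivAt_log (by linarith [hx.1])).const_mul _)
  have hmono : MonotoneOn φ (Set.Icc 1 z) := by
    refine monotoneOn_of_deriv_nonneg (convex_Icc 1 z)
      (fun x hx ↦ (hd x hx).continuousAt.continuousWithinAt)
      (fun x hx ↦ (hd x (interior_subset hx)).differentiableAt.differentiableWithinAt)
      (fun x hx ↦ ?_)
    have hx' := interior_subset hx
    rw [(hd x hx').deriv]
    have ha := hα x hx'.1
    have hb := hβ x hx'
    have hx0 : 0 < x := by linarith [hx'.1]
    have key : ((p : ℝ) + k + 1) / ((p + k + 1) * x - p)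
        - (-(p + 1)) / (p + k - (p + 1) * x) - k * x⁻¹ =
        k * (x * (p + k + p + 1) - ((p + k + 1) * x - p) * (p + k - (p + 1) * x)) /
          (((p + k + 1) * x - p) * (p + k - (p + 1) * x) * x) := by
      have gen : ∀ A B X Y : ℝ, A ≠ 0 → B ≠ 0 → X / A - Y / B - k * x⁻¹ =
          (X * B * x - Y * A * x - k * (A * B)) / (A * B * x) := fun A B X Y hA hB ↦ by
        field_simp
      rw [gen _ _ _ _ ha.ne' hb.ne']
      congr 1
      ring
    rw [key]
    refine div_nonneg (mul_nonneg hk0 ?_) (by positivity)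
    obtain ⟨y, rfl⟩ : ∃ y, x = 1 + y := ⟨x - 1, by ring⟩
    have hy : 0 ≤ y := by linarith [hx'.1]
    have e : (1 + y) * ((p : ℝ) + k + p + 1)
        - ((p + k + 1) * (1 + y) - p) * (p + k - (p + 1) * (1 + y)) =
        (p + (p + k) + 2 - k ^ 2) + (p + (p + k) + 2 - k ^ 2 + (p + (p + k) + 1)) * y
          + (p + k + 1) * (p + 1) * y ^ 2 := by
      ring
    rw [e]
    have : (0 : ℝ) ≤ p + (p + k) + 2 - k ^ 2 := by linarith
    positivity
  have hle := hmono (Set.left_mem_Icc.2 hz) (Set.right_mem_Icc.2 hz) hz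
  have hz0 : 0 < z := by linarith
  have ha := hα z hz
  have ha1 := hα 1 le_rfl
  have hb1 := hβ 1 (Set.left_mem_Icc.2 hz)
  have hle' : Real.log (((p + k + 1) * 1 - p) * (p + k - (p + 1) * z) * z ^ k) ≤
      Real.log (((p + k + 1) * z - p) * (p + k - (p + 1) * 1)) := by
    rw [Real.log_mul (by positivity) (by positivity), Real.log_mul ha1.ne' h.ne',
      Real.log_mul ha.ne' hb1.ne', Real.log_pow]
    simp only [φ, Real.log_one] at hle
    linarith
  rw [Real.log_le_log_iff (by positivity) (by positivity)] at hle'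
  set Z := (p + k - ((p : ℝ) + 1) * z) * z ^ k with hZ
  set α := ((p : ℝ) + k + 1) * z - p
  have h1 : (k + 1) * Z ≤ α * (k - 1) := by
    rw [hZ]; linarith
  have h2 : ((p : ℝ) + k + 1) * (k - 1) < (p + 1) * (k + 1) := by nlinarith
  have h3 : (k + 1) * (((p : ℝ) + 1) * α - (p + k + 1) * Z) > 0 := by
    have e1 := mul_le_mul_of_nonneg_left h1 (by positivity : (0 : ℝ) ≤ p + k + 1)
    have e2 := mul_lt_mul_of_pos_left h2 ha
    nlinarith
  have h4 := pos_of_mul_pos_right h3 (by positivity)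
  rw [hZ] at h4
  linarith

lemma exists_gap (p w : ℕ) (hpw : p ≤ w) (hk : (w - p) ^ 2 < p + w + 2) (R : ℝ) :
    ∃ c > 0, ∀ z ∈ Set.Icc 1 R,
      c ≤ ((p : ℝ) + 1) * ((w + 1) * z - p) - (w + 1) * z ^ (w - p) * (w - (p + 1) * z) := by
  rcases lt_or_ge R 1 with hR | hR
  · exact ⟨1, one_pos, fun z hz ↦ absurd (hz.1.trans hz.2) (not_le.2 hR)⟩
  obtain ⟨x, hx, hmin⟩ := isCompact_Icc.exists_isMinOn (Set.nonempty_Icc.2 hR)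
    (f := fun z : ℝ ↦ ((p : ℝ) + 1) * ((w + 1) * z - p)
      - (w + 1) * z ^ (w - p) * (w - (p + 1) * z)) (by fun_prop)
  exact ⟨_, gap_pos p w hpw hk x hx.1, fun z hz ↦ hmin hz⟩

/-- The increment inequality with binomial coefficients replaced by powers. -/
lemma exists_bracket_pos (p w : ℕ) (hpw : p ≤ w) (hk : (w - p) ^ 2 < p + w + 2) :
    ∃ M : ℕ, ∀ u ≥ M, ∀ μ : ℕ, u ≤ μ → μ * (p + 1) ≤ w * u →
      0 < ((p : ℝ) + 1) * ((u : ℝ) - w) ^ (w - p) * (μ * (w + 1) - p * u)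
        + (w + 1) * (μ : ℝ) ^ (w - p) * (μ * (p + 1) - w * u) := by
  obtain ⟨c, hc, hgap⟩ := exists_gap p w hpw hk w
  set k := w - p
  obtain ⟨M, hM⟩ := exists_nat_gt (k * w * ((p + 1) * ((w + 1) * w)) / c)
  refine ⟨max (max M w) 1, fun u hu μ huμ hμ ↦ ?_⟩
  have hu1 : 1 ≤ u := le_trans (le_max_right _ _) hu
  have huw : w ≤ u := le_trans ((le_max_right _ _).trans (le_max_left _ _)) hu
  have huM : M ≤ u := le_trans ((le_max_left _ _).trans (le_max_left _ _)) hu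
  have hu0 : (0 : ℝ) < u := by exact_mod_cast hu1
  have huw' : (w : ℝ) ≤ u := by exact_mod_cast huw
  obtain ⟨z, hz⟩ : ∃ z : ℝ, z * u = μ := ⟨μ / u, by field_simp⟩
  have hz1 : 1 ≤ z := by
    have : (u : ℝ) ≤ μ := by exact_mod_cast huμ
    nlinarith
  have hzw : z * (p + 1) ≤ w := by
    have : (μ : ℝ) * (p + 1) ≤ w * u := by exact_mod_cast hμ
    rw [← hz] at this
    nlinarith
  have hp : (0 : ℝ) ≤ p := p.cast_nonneg
  have hzw' : z ≤ w := by nlinarith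
  have hg := hgap z ⟨hz1, hzw'⟩
  have hb : 1 - k * (w / u) ≤ (1 - (w : ℝ) / u) ^ k := by
    have : (w : ℝ) / u ≤ 1 := (div_le_one hu0).2 huw'
    have := one_add_mul_le_pow (a := -((w : ℝ) / u)) (by linarith) k
    simpa [sub_eq_add_neg] using this
  have hpow : ((u : ℝ) - w) ^ k = u ^ k * (1 - (w : ℝ) / u) ^ k := by
    rw [← mul_pow]; congr 1; field_simp
  have e : ((p : ℝ) + 1) * ((u : ℝ) - w) ^ k * (μ * (w + 1) - p * u)
        + (w + 1) * (μ : ℝ) ^ k * (μ * (p + 1) - w * u) =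
      u ^ (k + 1) * ((p + 1) * (1 - (w : ℝ) / u) ^ k * ((w + 1) * z - p)
        - (w + 1) * z ^ k * (w - (p + 1) * z)) := by
    rw [hpow, ← hz, mul_pow]; ring
  rw [e]
  refine mul_pos (by positivity) ?_
  have hα : 0 ≤ ((w : ℝ) + 1) * z - p := by
    have : (p : ℝ) ≤ w := by exact_mod_cast hpw
    nlinarith
  have h1 := mul_le_mul_of_nonneg_left hb (mul_nonneg (by positivity : 0 ≤ (p : ℝ) + 1) hα)
  have h2 : (p + 1) * (((w : ℝ) + 1) * z - p) * (k * (w / u)) < c := by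
    have h3 : (p + 1) * (((w : ℝ) + 1) * z - p) * (k * (w / u)) ≤
        (p + 1) * (((w : ℝ) + 1) * w) * (k * (w / u)) := by
      gcongr
      nlinarith
    refine h3.trans_lt ?_
    rw [div_lt_iff₀ hc] at hM
    have : (M : ℝ) ≤ u := by exact_mod_cast huM
    rw [show (p + 1) * (((w : ℝ) + 1) * w) * (k * (w / u)) =
      (k * w * ((p + 1) * ((w + 1) * w))) / u by ring, div_lt_iff₀ hu0]
    nlinarith
  nlinarith

lemma choose_succ_increment (m b p w : ℕ) :
    ((m : ℝ) + 1) * (b + 1) * (((m.choose p : ℝ) * (b + 1).choose (w + 1)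
        + m.choose w * (b + 1).choose (p + 1))
        - ((m + 1).choose p * b.choose (w + 1) + (m + 1).choose w * b.choose (p + 1))) =
      (m + 1).choose p * (b + 1).choose (w + 1) * ((m + 1) * (w + 1) - p * (b + 1))
        + (m + 1).choose w * (b + 1).choose (p + 1) * ((m + 1) * (p + 1) - w * (b + 1)) := by
  have key : ∀ n k : ℕ, (n.choose k : ℝ) * (n + 1) = (n + 1).choose k * (n + 1 - k) := by
    intro n k
    rcases le_or_gt k (n + 1) with h | h
    · have := Nat.choose_mul_succ_eq n k
      have h' : ((n + 1 - k : ℕ) : ℝ) = n + 1 - k := by push_cast [Nat.cast_sub h]; ring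
      rw [← h']
      exact_mod_cast this
    · simp [Nat.choose_eq_zero_of_lt h, Nat.choose_eq_zero_of_lt (Nat.lt_of_succ_lt h)]
  have h1 := key m p
  have h2 := key m w
  have h3 := key b (p + 1)
  have h4 := key b (w + 1)
  push_cast at h3 h4
  linear_combination ((b : ℝ) + 1) * (b + 1).choose (w + 1) * h1
    + ((b : ℝ) + 1) * (b + 1).choose (p + 1) * h2
    - ((m : ℝ) + 1) * (m + 1).choose p * h4 - ((m : ℝ) + 1) * (m + 1).choose w * h3

lemma exists_choose_increment_pos (p w : ℕ) (hpw : p ≤ w) (hk : (w - p) ^ 2 < p + w + 2) :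
    ∃ M : ℕ, ∀ m ≥ M, ∀ b ≤ m, p ≤ b →
      (m + 1).choose p * b.choose (w + 1) + (m + 1).choose w * b.choose (p + 1) <
      m.choose p * (b + 1).choose (w + 1) + m.choose w * (b + 1).choose (p + 1) := by
  obtain ⟨M, hM⟩ := exists_bracket_pos p w hpw hk
  refine ⟨(M + w + 1) * w + w, fun m hm b hbm hpb ↦ ?_⟩
  have hid := choose_succ_increment m b p w
  suffices h : 0 < ((m + 1).choose p : ℝ) * (b + 1).choose (w + 1)
        * ((m + 1) * (w + 1) - p * (b + 1))
        + (m + 1).choose w * (b + 1).choose (p + 1) * ((m + 1) * (p + 1) - w * (b + 1)) by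
    rw [← hid] at h
    have := pos_of_mul_pos_right h (by positivity)
    rw [sub_pos] at this
    exact_mod_cast this
  have hα : 0 < ((m : ℝ) + 1) * (w + 1) - p * (b + 1) := by
    have h1 : (b : ℝ) ≤ m := by exact_mod_cast hbm
    have h2 : (p : ℝ) ≤ w := by exact_mod_cast hpw
    nlinarith [mul_le_mul h2 h1 (by positivity) (by positivity)]
  have hwm : w ≤ m + 1 := by nlinarith
  have hP : 0 < (b + 1).choose (p + 1) := Nat.choose_pos (by omega)
  rcases lt_or_ge (w * (b + 1)) ((m + 1) * (p + 1)) with h | h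
  · have hβ : (0 : ℝ) < (m + 1) * (p + 1) - w * (b + 1) := by
      rw [sub_pos]; exact_mod_cast h
    have : 0 < (m + 1).choose w := Nat.choose_pos hwm
    positivity
  have hw0 : 0 < w := by
    rcases Nat.eq_zero_or_pos w with rfl | h0
    · simp at h
    · exact h0
  have hbM : M + w ≤ b := by
    by_contra! hlt
    have : w * (b + 1) ≤ w * (M + w + 1) := Nat.mul_le_mul_left _ (by omega)
    nlinarith
  have hbr := hM (b + 1) (by omega) (m + 1) (by omega) h
  set k := w - p with hkdef
  have hf1 : ((p + 1).factorial : ℝ) * (b + 1).choose (p + 1) * ((b + 1 : ℕ) - w : ℝ) ^ k ≤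
      (w + 1).factorial * (b + 1).choose (w + 1) := by
    have e := Nat.descFactorial_mul_descFactorial (n := b + 1) (k := p + 1) (m := w + 1) (by omega)
    have l := Nat.pow_sub_le_descFactorial (b + 1 - (p + 1)) k
    rw [Nat.descFactorial_eq_factorial_mul_choose (b + 1) (w + 1),
      Nat.descFactorial_eq_factorial_mul_choose (b + 1) (p + 1),
      show w + 1 - (p + 1) = k by omega] at e
    rw [show b + 1 - (p + 1) + 1 - k = b + 1 - w by omega] at l
    have := Nat.mul_le_mul_right ((p + 1).factorial * (b + 1).choose (p + 1)) l
    rw [e] at this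
    rw [← Nat.cast_sub (by omega), mul_comm]
    exact_mod_cast this
  have hf2 : (w.factorial : ℝ) * (m + 1).choose w ≤
      p.factorial * (m + 1).choose p * ((m + 1 : ℕ) : ℝ) ^ k := by
    have e := Nat.descFactorial_mul_descFactorial (n := m + 1) hpw
    have l := (Nat.descFactorial_le_pow (m + 1 - p) k).trans
      (Nat.pow_le_pow_left (Nat.sub_le (m + 1) p) k)
    rw [Nat.descFactorial_eq_factorial_mul_choose (m + 1) w,
      Nat.descFactorial_eq_factorial_mul_choose (m + 1) p] at e
    have := Nat.mul_le_mul_right (p.factorial * (m + 1).choose p) l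
    rw [e] at this
    rw [mul_comm (_ * _) (_ ^ k)]
    exact_mod_cast this
  have hβ : ((m : ℝ) + 1) * (p + 1) - w * (b + 1) ≤ 0 := by
    rw [sub_nonpos]; exact_mod_cast h
  rw [Nat.factorial_succ p] at hf1
  rw [Nat.factorial_succ w] at hf1
  push_cast at hf1 hf2 hbr
  have hq : 0 < (m + 1).choose p := Nat.choose_pos (by omega)
  set α := ((m : ℝ) + 1) * (w + 1) - p * (b + 1)
  set β := ((m : ℝ) + 1) * (p + 1) - w * (b + 1)
  have t1 := mul_le_mul_of_nonneg_right hf1 (mul_nonneg (Nat.cast_nonneg ((m + 1).choose p)) hα.le)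
  have t2 := mul_le_mul_of_nonpos_right hf2
    (mul_nonpos_of_nonneg_of_nonpos (by positivity : (0 : ℝ) ≤ (w + 1) * (b + 1).choose (p + 1)) hβ)
  have t3 := mul_pos (by positivity : (0 : ℝ) < p.factorial * (m + 1).choose p
    * (b + 1).choose (p + 1)) hbr
  have t4 : 0 < ((w : ℝ) + 1) * w.factorial * (((m + 1).choose p : ℝ) * (b + 1).choose (w + 1) * α
      + (m + 1).choose w * (b + 1).choose (p + 1) * β) := by
    linarith
  exact pos_of_mul_pos_right t4 (by positivity)

lemma nonempty_iso_Kmulti_iff {V : Type*} [Finite V] {G : SimpleGraph V} {q s t : ℕ}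
    (hq : 0 < q) (hs : 0 < s) (ht : 0 < t) (c : V → Fin q)
    (hG : ∀ v w, G.Adj v w ↔ c v ≠ c w) (H : G.Subgraph) :
    Nonempty (H.coe ≃g Kmulti q s t) ↔
      H.IsInduced ∧ ∃ i, ∀ j, {v ∈ H.verts | c v = j}.ncard = if j = i then t else s := by
  have hcard : ∀ j : Fin q, {v ∈ H.verts | c v = j}.ncard
      = Nat.card {v : H.verts // c v = j} := fun j ↦ by
    rw [← Nat.card_coe_set_eq]
    exact Nat.card_congr (Equiv.subtypeSubtypeEquivSubtypeInter (· ∈ H.verts) (c · = j)).symm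
  constructor
  · rintro ⟨e⟩
    have hpos : ∀ i : Fin q, 0 < if (i : ℕ) = 0 then t else s := fun i ↦ by split_ifs <;> assumption
    let rep : ∀ i : Fin q, Σ i : Fin q, Fin (if (i : ℕ) = 0 then t else s) :=
      fun i ↦ ⟨i, ⟨0, hpos i⟩⟩
    have hne : ∀ x y, (Kmulti q s t).Adj x y → c (e.symm x) ≠ c (e.symm y) := fun x y h ↦
      (hG _ _).1 (H.adj_sub (e.symm.map_adj_iff.2 h))
    let σ : Fin q → Fin q := fun i ↦ c (e.symm (rep i))
    have hσ : Function.Bijective σ := by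
      rw [← Finite.injective_iff_bijective]
      intro i j hij
      by_contra h
      exact hne (rep i) (rep j) h hij
    have hc : ∀ x, c (e.symm x) = σ x.1 := fun x ↦ by
      obtain ⟨j, hj⟩ := hσ.2 (c (e.symm x))
      rw [← hj]
      by_contra h
      have : x.1 ≠ j := fun h' ↦ h (by rw [h'])
      exact hne x (rep j) this hj.symm
    have hc' : ∀ v : H.verts, c v = σ (e v).1 := fun v ↦ by rw [← hc, e.symm_apply_apply]
    refine ⟨fun v hv w hw hvw ↦ ?_, σ ⟨0, hq⟩, fun j ↦ ?_⟩
    · have : (Kmulti q s t).Adj (e ⟨v, hv⟩) (e ⟨w, hw⟩) := fun h ↦ by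
        refine (hG v w).1 hvw ?_
        rw [hc' ⟨v, hv⟩, hc' ⟨w, hw⟩]
        exact congrArg σ h
      exact e.map_adj_iff.1 this
    · obtain ⟨i, rfl⟩ := hσ.2 j
      have e1 : {v : H.verts // c v = σ i} ≃ {x : Σ i : Fin q, Fin _ // x.1 = i} :=
        e.toEquiv.subtypeEquiv fun v ↦ by rw [hc' v]; exact hσ.1.eq_iff
      rw [hcard, Nat.card_congr (e1.trans (Equiv.sigmaSubtype i)), Nat.card_fin]
      simp [hσ.1.eq_iff, Fin.ext_iff]
  · rintro ⟨hind, i, hi⟩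
    let σ : Equiv.Perm (Fin q) := Equiv.swap i ⟨0, hq⟩
    have hfib : ∀ j, Nat.card {v : H.verts // c v = j}
        = if ((σ j : Fin q) : ℕ) = 0 then t else s := fun j ↦ by
      rw [← hcard, hi]
      congr 1
      have : ((σ j : Fin q) : ℕ) = 0 ↔ σ j = σ i := by
        rw [show σ i = ⟨0, hq⟩ from Equiv.swap_apply_left _ _, Fin.ext_iff]
      rw [this, σ.injective.eq_iff]
    let e : H.verts ≃ Σ i : Fin q, Fin (if (i : ℕ) = 0 then t else s) :=
      (Equiv.sigmaFiberEquiv fun v : H.verts ↦ c v).symm.trans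
        (Equiv.sigmaCongr σ fun j ↦ Finite.equivFinOfCardEq (hfib j))
    have he : ∀ v, (e v).1 = σ (c v) := fun v ↦ rfl
    refine ⟨⟨e, fun {v w} ↦ ?_⟩⟩
    change (e v).1 ≠ (e w).1 ↔ H.Adj v w
    rw [hind.adj, hG, he, he, σ.injective.ne_iff]

lemma copies_Kmulti {V : Type*} [Finite V] {G : SimpleGraph V} {q s t : ℕ}
    (hq : 0 < q) (hs : 0 < s) (ht : 0 < t) (c : V → Fin q)
    (hG : ∀ v w, G.Adj v w ↔ c v ≠ c w) :
    copies (Kmulti q s t) G =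
      Nat.card {W : Set V // ∃ i, ∀ j, {v ∈ W | c v = j}.ncard = if j = i then t else s} := by
  refine Nat.card_congr
    { toFun := fun H ↦ ⟨H.1.verts, ((nonempty_iso_Kmulti_iff hq hs ht c hG H.1).1 H.2).2⟩
      invFun := fun W ↦ ⟨(⊤ : G.Subgraph).induce W.1,
        (nonempty_iso_Kmulti_iff hq hs ht c hG _).2
          ⟨(Subgraph.isInduced_iff_exists_eq_induce_top _).2 ⟨_, rfl⟩, W.2⟩⟩
      left_inv := fun H ↦ Subtype.ext
        ((nonempty_iso_Kmulti_iff hq hs ht c hG H.1).1 H.2).1.induce_top_verts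
      right_inv := fun W ↦ rfl }

open Classical in
lemma copies_turanGraph {q s t : ℕ} (hq : 0 < q) (hs : 0 < s) (ht : 0 < t) (a : ℕ) :
    copies (Kmulti q s t) (turanGraph a q) =
      ((Finset.range a).powerset.filter fun W ↦ ∃ i < q, ∀ j < q,
        (W.filter (· % q = j)).card = if j = i then t else s).card := by
  rw [copies_Kmulti hq hs ht (fun v : Fin a ↦ ⟨v % q, Nat.mod_lt _ hq⟩)
    (fun v w ↦ by rw [turanGraph_adj, Ne, Ne, Fin.mk.injEq])]
  let f : Set (Fin a) → Finset ℕ := fun W ↦ W.toFinset.map Fin.valEmbedding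
  have hf : ∀ W : Set (Fin a), ∀ j : Fin q,
      {v ∈ W | (⟨v % q, Nat.mod_lt _ hq⟩ : Fin q) = j}.ncard
        = ((f W).filter (· % q = (j : ℕ))).card := fun W j ↦ by
    rw [← Set.ncard_image_of_injective _ Fin.val_injective, ← Set.ncard_coe_finset]
    congr 1
    ext x
    simp only [f, Fin.ext_iff, Set.mem_image, Set.mem_ofPred_eq, Finset.coe_filter,
      Finset.mem_map, Set.mem_toFinset, Fin.valEmbedding_apply]
    constructor
    · rintro ⟨v, ⟨hv, h⟩, rfl⟩
      exact ⟨⟨v, hv, rfl⟩, h⟩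
    · rintro ⟨⟨v, hv, rfl⟩, h⟩
      exact ⟨v, ⟨hv, h⟩, rfl⟩
  have hiff : ∀ W : Set (Fin a), (∃ i : Fin q, ∀ j : Fin q,
      {v ∈ W | (⟨v % q, Nat.mod_lt _ hq⟩ : Fin q) = j}.ncard = if j = i then t else s) ↔
      ∃ i < q, ∀ j < q, ((f W).filter (· % q = j)).card = if j = i then t else s := fun W ↦ by
    simp only [hf, Fin.exists_iff, Fin.forall_iff, Fin.mk.injEq, exists_prop]
  simp only [hiff]
  rw [Nat.subtype_card (Finset.univ.filter fun W : Set (Fin a) ↦ ∃ i < q, ∀ j < q,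
    ((f W).filter (· % q = j)).card = if j = i then t else s) (by simp)]
  refine Finset.card_nbij f (fun W hW ↦ ?_) (fun W _ W' _ h ↦ ?_) (fun U hU ↦ ?_)
  · simp only [Finset.coe_filter, Finset.mem_univ, true_and, Set.mem_ofPred_eq,
      Finset.mem_powerset] at hW ⊢
    refine ⟨fun x hx ↦ ?_, hW⟩
    obtain ⟨v, -, rfl⟩ := Finset.mem_map.1 hx
    exact Finset.mem_range.2 v.2
  · exact Set.toFinset_inj.1 (Finset.map_injective _ h)
  · simp only [Finset.coe_filter, Set.mem_ofPred_eq, Finset.mem_powerset] at hU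
    have hfU : f {v | (v : ℕ) ∈ U} = U := by
      ext x
      simp only [f, Finset.mem_map, Set.mem_toFinset, Set.mem_ofPred_eq, Fin.valEmbedding_apply]
      exact ⟨fun ⟨v, hv, e⟩ ↦ e ▸ hv, fun hx ↦ ⟨⟨x, Finset.mem_range.1 (hU.1 hx)⟩, hx, rfl⟩⟩
    refine ⟨{v | (v : ℕ) ∈ U}, ?_, hfU⟩
    simp only [Finset.coe_filter, Finset.mem_univ, true_and, Set.mem_ofPred_eq, hfU]
    exact hU.2

open Classical in
/-- Splitting off one residue class when counting sets with prescribed class sizes. -/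
lemma card_profile {q s t j₀ : ℕ} (hj₀ : j₀ < q) (a : ℕ) :
    ((Finset.range a).powerset.filter fun W ↦ ∃ i < q, ∀ j < q,
        (W.filter (· % q = j)).card = if j = i then t else s).card =
      ((Finset.range a).filter (· % q = j₀)).card.choose t *
        (((Finset.range a).filter (· % q ≠ j₀)).powerset.filter fun U ↦ ∀ j < q, j ≠ j₀ →
          (U.filter (· % q = j)).card = s).card +
      ((Finset.range a).filter (· % q = j₀)).card.choose s *
        (((Finset.range a).filter (· % q ≠ j₀)).powerset.filter fun U ↦
          s ≠ t ∧ ∃ i < q, i ≠ j₀ ∧ ∀ j < q, j ≠ j₀ →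
            (U.filter (· % q = j)).card = if j = i then t else s).card := by
  rw [← Finset.card_powersetCard, ← Finset.card_powersetCard, ← Finset.card_product,
    ← Finset.card_product, ← Finset.card_union_of_disjoint]
  · have hP : ∀ x y : Finset ℕ, (∀ v ∈ x, v % q = j₀) → (∀ v ∈ y, v % q ≠ j₀) →
        (x ∪ y).filter (· % q = j₀) = x := fun x y hx hy ↦ by
      rw [Finset.filter_union, Finset.filter_true_of_mem hx, Finset.filter_false_of_mem hy,
        Finset.union_empty]
    have hQ : ∀ x y : Finset ℕ, (∀ v ∈ x, v % q = j₀) → (∀ v ∈ y, v % q ≠ j₀) →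
        (x ∪ y).filter (· % q ≠ j₀) = y := fun x y hx hy ↦ by
      rw [Finset.filter_union, Finset.filter_true_of_mem hy,
        Finset.filter_false_of_mem (fun v hv ↦ not_not.2 (hx v hv)), Finset.empty_union]
    have hR : ∀ (W : Finset ℕ) (j : ℕ), j ≠ j₀ →
        (W.filter (· % q ≠ j₀)).filter (· % q = j) = W.filter (· % q = j) := fun W j hj ↦ by
      rw [Finset.filter_filter]
      exact Finset.filter_congr fun v _ ↦ ⟨fun h ↦ h.2, fun h ↦ ⟨h ▸ hj, h⟩⟩
    have hsplit : ∀ W : Finset ℕ, (∃ i < q, ∀ j < q,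
        (W.filter (· % q = j)).card = if j = i then t else s) ↔
        ((W.filter (· % q = j₀)).card = t ∧ ∀ j < q, j ≠ j₀ →
          ((W.filter (· % q ≠ j₀)).filter (· % q = j)).card = s) ∨
        ((W.filter (· % q = j₀)).card = s ∧ s ≠ t ∧ ∃ i < q, i ≠ j₀ ∧ ∀ j < q, j ≠ j₀ →
          ((W.filter (· % q ≠ j₀)).filter (· % q = j)).card = if j = i then t else s) := by
      intro W
      constructor
      · rintro ⟨i, hi, h⟩
        by_cases hst : i = j₀ ∨ s = t
        · refine Or.inl ⟨?_, fun j hj hne ↦ ?_⟩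
          · rw [h j₀ hj₀]; grind
          · rw [hR W j hne, h j hj]; grind
        · rw [not_or] at hst
          refine Or.inr ⟨?_, hst.2, i, hi, hst.1, fun j hj hne ↦ ?_⟩
          · rw [h j₀ hj₀, if_neg (Ne.symm hst.1)]
          · rw [hR W j hne, h j hj]
      · rintro (⟨h0, h⟩ | ⟨h0, -, i, hi, hne, h⟩)
        · refine ⟨j₀, hj₀, fun j hj ↦ ?_⟩
          split_ifs with hjj
          · rw [hjj, h0]
          · rw [← hR W j hjj, h j hj hjj]
        · refine ⟨i, hi, fun j hj ↦ ?_⟩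
          by_cases hjj : j = j₀
          · rw [hjj, h0, if_neg (Ne.symm hne)]
          · rw [← hR W j hjj, h j hj hjj]
    refine Finset.card_nbij' (fun W ↦ (W.filter (· % q = j₀), W.filter (· % q ≠ j₀)))
      (fun x ↦ x.1 ∪ x.2) (fun W hW ↦ ?_) (fun x hx ↦ ?_) (fun W _ ↦ ?_) (fun x hx ↦ ?_)
    · simp only [Finset.coe_filter, Set.mem_ofPred_eq, Finset.mem_powerset, hsplit] at hW
      have s1 := Finset.filter_subset_filter (· % q = j₀) hW.1
      have s2 := Finset.filter_subset_filter (· % q ≠ j₀) hW.1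
      simp only [Finset.coe_union, Set.mem_union, Finset.mem_coe, Finset.mem_product,
        Finset.mem_powersetCard, Finset.mem_filter, Finset.mem_powerset]
      exact hW.2.imp (fun h ↦ ⟨⟨s1, h.1⟩, s2, h.2⟩) (fun h ↦ ⟨⟨s1, h.1⟩, s2, h.2⟩)
    · have hx' : x.1 ⊆ (Finset.range a).filter (· % q = j₀) ∧
          x.2 ⊆ (Finset.range a).filter (· % q ≠ j₀) := by
        simp only [Finset.coe_union, Set.mem_union, Finset.mem_coe, Finset.mem_product,
          Finset.mem_powersetCard, Finset.mem_filter, Finset.mem_powerset] at hx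
        exact hx.elim (fun h ↦ ⟨h.1.1, h.2.1⟩) (fun h ↦ ⟨h.1.1, h.2.1⟩)
      have h1 : ∀ v ∈ x.1, v % q = j₀ := fun v hv ↦ (Finset.mem_filter.1 (hx'.1 hv)).2
      have h2 : ∀ v ∈ x.2, v % q ≠ j₀ := fun v hv ↦ (Finset.mem_filter.1 (hx'.2 hv)).2
      simp only [Finset.coe_filter, Set.mem_ofPred_eq, Finset.mem_powerset, hsplit,
        hP _ _ h1 h2, hQ _ _ h1 h2]
      refine ⟨Finset.union_subset (hx'.1.trans (Finset.filter_subset _ _))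
        (hx'.2.trans (Finset.filter_subset _ _)), ?_⟩
      simp only [Finset.coe_union, Set.mem_union, Finset.mem_coe, Finset.mem_product,
        Finset.mem_powersetCard, Finset.mem_filter, Finset.mem_powerset] at hx
      exact hx.imp (fun h ↦ ⟨h.1.2, h.2.2⟩) (fun h ↦ ⟨h.1.2, h.2.2⟩)
    · exact Finset.filter_union_filter_not_eq _ _
    · have hx' : x.1 ⊆ (Finset.range a).filter (· % q = j₀) ∧
          x.2 ⊆ (Finset.range a).filter (· % q ≠ j₀) := by
        simp only [Finset.coe_union, Set.mem_union, Finset.mem_coe, Finset.mem_product,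
          Finset.mem_powersetCard, Finset.mem_filter, Finset.mem_powerset] at hx
        exact hx.elim (fun h ↦ ⟨h.1.1, h.2.1⟩) (fun h ↦ ⟨h.1.1, h.2.1⟩)
      have h1 : ∀ v ∈ x.1, v % q = j₀ := fun v hv ↦ (Finset.mem_filter.1 (hx'.1 hv)).2
      have h2 : ∀ v ∈ x.2, v % q ≠ j₀ := fun v hv ↦ (Finset.mem_filter.1 (hx'.2 hv)).2
      exact Prod.ext (hP _ _ h1 h2) (hQ _ _ h1 h2)
  · rw [Finset.disjoint_left]
    intro x hx hx'
    simp only [Finset.mem_product, Finset.mem_powersetCard, Finset.mem_filter] at hx hx'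
    exact hx'.2.2.1 (hx'.1.2.symm.trans hx.1.2)

lemma card_filter_mod_range {q : ℕ} (hq : 0 < q) (a j : ℕ) (hj : j < q) :
    ((Finset.range a).filter (· % q = j)).card = a / q + if j < a % q then 1 else 0 := by
  have h := Nat.count_modEq_card a hq j
  rw [Nat.count_eq_card_filter_range, Nat.mod_eq_of_lt hj] at h
  rw [← h]
  refine congrArg _ (Finset.filter_congr fun x _ ↦ ?_)
  rw [Nat.ModEq, Nat.mod_eq_of_lt hj]

open Classical in
/-- Adding one vertex to a Turán graph changes the number of copies only through the size of the
part receiving that vertex. -/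
lemma exists_copies_turanGraph_step {q s t : ℕ} (hq : 0 < q) (hs : 0 < s) (ht : 0 < t) (a : ℕ) :
    ∃ A B : ℕ, (q * s ≤ a → 0 < A) ∧
      copies (Kmulti q s t) (turanGraph a q) = (a / q).choose t * A + (a / q).choose s * B ∧
      copies (Kmulti q s t) (turanGraph (a + 1) q) =
        (a / q + 1).choose t * A + (a / q + 1).choose s * B ∧
      copies (Kmulti q s s) (turanGraph a q) = (a / q).choose s * A ∧
      copies (Kmulti q s s) (turanGraph (a + 1) q) = (a / q + 1).choose s * A := by
  have hj₀ := Nat.mod_lt a hq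
  have hc : ((Finset.range a).filter (· % q = a % q)).card = a / q := by
    rw [card_filter_mod_range hq a _ hj₀, if_neg (lt_irrefl _), add_zero]
  have hc' : ((Finset.range (a + 1)).filter (· % q = a % q)).card = a / q + 1 := by
    rw [Finset.range_add_one, Finset.filter_insert, if_pos rfl, Finset.card_insert_of_notMem
      (by simp), hc]
  have hQ : (Finset.range (a + 1)).filter (· % q ≠ a % q)
      = (Finset.range a).filter (· % q ≠ a % q) := by
    rw [Finset.range_add_one, Finset.filter_insert, if_neg (not_not.2 rfl)]
  simp only [copies_turanGraph hq hs ht, copies_turanGraph hq hs hs, card_profile hj₀, hc, hc', hQ]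
  refine ⟨_, _, fun ha ↦ ?_, rfl, rfl, by simp, by simp⟩
  refine Finset.card_pos.2 ⟨(Finset.range (q * s)).filter (· % q ≠ a % q), ?_⟩
  simp only [Finset.mem_filter, Finset.mem_powerset]
  refine ⟨Finset.filter_subset_filter _ (Finset.range_subset_range.2 ha), fun j hj hne ↦ ?_⟩
  rw [Finset.filter_filter, Finset.filter_congr (q := (· % q = j))
    fun v _ ↦ ⟨fun h ↦ h.2, fun h ↦ ⟨h ▸ hne, h⟩⟩, card_filter_mod_range hq _ _ hj]
  simp [hq]

lemma choose_increment_le (m b p : ℕ) (hb : b ≤ m) :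
    (m + 1).choose p * b.choose (p + 1) ≤ m.choose p * (b + 1).choose (p + 1) := by
  have h1 := Nat.choose_mul_succ_eq m p
  have h2 := Nat.choose_mul_succ_eq b (p + 1)
  rcases lt_or_ge b p with h | h
  · rw [Nat.choose_eq_zero_of_lt (by omega : b < p + 1)]; simp
  obtain ⟨x, rfl⟩ := Nat.exists_eq_add_of_le h
  obtain ⟨y, rfl⟩ := Nat.exists_eq_add_of_le hb
  rw [show p + x + y + 1 - p = x + y + 1 by omega] at h1
  rw [show p + x + 1 - (p + 1) = x by omega] at h2
  refine Nat.le_of_mul_le_mul_left (c := (p + x + y + 1) * (p + x + 1)) ?_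
    (Nat.mul_pos (Nat.succ_pos _) (Nat.succ_pos _))
  calc _ = (p + x + y + 1) * (p + x + y + 1).choose p
          * ((p + x).choose (p + 1) * (p + x + 1)) := by ring
    _ = (p + x + y + 1).choose p * (p + x + 1).choose (p + 1)
          * ((p + x + y + 1) * x) := by rw [h2]; ring
    _ ≤ (p + x + y + 1).choose p * (p + x + 1).choose (p + 1)
          * ((p + x + 1) * (x + y + 1)) := Nat.mul_le_mul_left _ (by nlinarith)
    _ = ((p + x + y + 1).choose p * (x + y + 1)) * (p + x + 1)
          * (p + x + 1).choose (p + 1) := by ring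
    _ = _ := by rw [← h1]; ring

lemma Fval_step {q p w : ℕ} (hq : 0 < q) (hpw : p ≤ w) (hk : (w - p) ^ 2 < p + w + 2) :
    ∃ M : ℕ, ∀ n a : ℕ, (q + 1) * (M + 1) ≤ n → (q + 1) * (a + 1) ≤ q * n →
      Fval (q + 1) (p + 1) (w + 1) a n ≤ Fval (q + 1) (p + 1) (w + 1) (a + 1) n ∧
      (q * (p + 1) ≤ a →
        Fval (q + 1) (p + 1) (w + 1) a n < Fval (q + 1) (p + 1) (w + 1) (a + 1) n) := by
  obtain ⟨M, hM⟩ := exists_choose_increment_pos p w hpw hk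
  refine ⟨M, fun n a hn ha ↦ ?_⟩
  obtain ⟨A, B, hA, e1, e2, e3, e4⟩ :=
    exists_copies_turanGraph_step hq p.succ_pos w.succ_pos a
  have han : a + 1 < n := by
    by_contra! h
    nlinarith
  obtain ⟨m, rfl⟩ : ∃ m, n = m + a + 2 := ⟨n - a - 2, by omega⟩
  have hbm : a / q ≤ m := by
    refine Nat.le_of_lt_succ ((Nat.div_lt_iff_lt_mul hq).2 ?_)
    nlinarith
  have hmM : M ≤ m := by
    by_contra! h
    have : (q + 1) * (m + 1) < (q + 1) * (M + 1) := by gcongr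
    nlinarith
  have hF : ∀ x ≤ m + a + 1, Fval (q + 1) (p + 1) (w + 1) x (m + a + 2) =
      (if p = w then (1 / 2 : ℝ) else 1) *
        (((m + a + 1 - x).choose p * copies (Kmulti q (p + 1) (w + 1)) (turanGraph x q)
        + (m + a + 1 - x).choose w * copies (Kmulti q (p + 1) (p + 1)) (turanGraph x q) : ℕ) :
          ℝ) := fun x _ ↦ by
    simp [Fval]
  rw [hF a (by omega), hF (a + 1) (by omega), e1, e2, e3, e4,
    show m + a + 1 - a = m + 1 by omega, show m + a + 1 - (a + 1) = m by omega]
  have hlam : (0 : ℝ) < if p = w then (1 / 2 : ℝ) else 1 := by split_ifs <;> norm_num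
  rw [mul_le_mul_iff_right₀ hlam, mul_lt_mul_iff_right₀ hlam, Nat.cast_le, Nat.cast_lt]
  set b := a / q
  have hY := Nat.mul_le_mul_left B (choose_increment_le m b p hbm)
  have hle : (m + 1).choose p * b.choose (w + 1) + (m + 1).choose w * b.choose (p + 1) ≤
      m.choose p * (b + 1).choose (w + 1) + m.choose w * (b + 1).choose (p + 1) := by
    rcases le_or_gt p b with h | h
    · exact (hM m hmM b hbm h).le
    · simp [Nat.choose_eq_zero_of_lt (by omega : b < p + 1),
        Nat.choose_eq_zero_of_lt (by omega : b < w + 1)]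
  constructor
  · linarith [Nat.mul_le_mul_left A hle]
  · intro hab
    have hpb : p ≤ b := by
      refine le_trans p.le_succ ((Nat.le_div_iff_mul_le hq).2 ?_)
      rw [mul_comm]; exact hab
    linarith [Nat.mul_lt_mul_of_pos_left (hM m hmM b hbm hpb) (hA hab)]

theorem statement13 (r s t : ℕ) (hr : 2 ≤ r) (hs : 1 ≤ s) (hst : s ≤ t)
    (ht : (t : ℝ) < s + 1 / 2 + Real.sqrt (2 * s + 1 / 4)) :
    ∃ n₀ : ℕ, ∀ n ≥ n₀, ∀ d : ℕ, d ≤ n - 1 →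
      Fval r s t ((r - 1) * n / r) n ≤ Fval r s t d n → (r - 1) * n / r ≤ d := by
  obtain ⟨q, rfl⟩ : ∃ q, r = q + 1 := ⟨r - 1, by omega⟩
  obtain ⟨p, rfl⟩ : ∃ p, s = p + 1 := ⟨s - 1, by omega⟩
  obtain ⟨k, rfl⟩ := Nat.exists_eq_add_of_le hst
  have hk : k ^ 2 < p + (p + k) + 2 := by
    rcases Nat.eq_zero_or_pos k with rfl | hk0
    · simp
    have hk1 : (1 : ℝ) ≤ k := by exact_mod_cast hk0
    push_cast at ht
    have h : (k : ℝ) - 1 / 2 < Real.sqrt (2 * (p + 1) + 1 / 4) := by linarith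
    rw [Real.lt_sqrt (by linarith)] at h
    have : (k : ℝ) ^ 2 < p + (p + k) + 2 := by nlinarith
    exact_mod_cast this
  obtain ⟨M, hM⟩ := Fval_step (q := q) (p := p) (w := p + k) (by omega) (by omega)
    (by rwa [Nat.add_sub_cancel_left])
  rw [Nat.add_sub_cancel, show p + 1 + k = p + k + 1 by ring]
  refine ⟨(q + 1) * (M + p + 2), fun n hn d _ hF ↦ ?_⟩
  have hn' : (q + 1) * (M + 1) ≤ n := le_trans (Nat.mul_le_mul_left _ (by omega)) hn
  have hlarge : q * (p + 1) + 1 ≤ q * n / (q + 1) := by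
    rw [Nat.le_div_iff_mul_le q.succ_pos]
    have h1 := Nat.mul_le_mul_left q hn
    have h2 : (q * (p + 1) + 1) * (q + 1) ≤ q * ((q + 1) * (M + p + 2)) := by
      have : q * (p + 1) + 1 ≤ q * (M + p + 2) := by nlinarith
      calc _ ≤ q * (M + p + 2) * (q + 1) := Nat.mul_le_mul_right _ this
        _ = _ := by ring
    exact h2.trans h1
  have hmul := Nat.div_mul_le_self (q * n) (q + 1)
  obtain ⟨a, ha⟩ : ∃ a, q * n / (q + 1) = a + 1 := ⟨q * n / (q + 1) - 1, by omega⟩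
  rw [ha] at hF hlarge hmul ⊢
  by_contra! hd
  have hstep : ∀ x ≤ a, (q + 1) * (x + 1) ≤ q * n := fun x hx ↦ by nlinarith
  have hmono : ∀ j, d + j ≤ a → Fval (q + 1) (p + 1) (p + k + 1) d n ≤
      Fval (q + 1) (p + 1) (p + k + 1) (d + j) n := by
    intro j
    induction j with
    | zero => intro _; rfl
    | succ j ih =>
      intro h
      exact (ih (by omega)).trans (hM n (d + j) hn' (hstep _ (by omega))).1
  have h1 := hmono (a - d) (by omega)
  rw [show d + (a - d) = a by omega] at h1
  exact absurd hF (not_le.2 (h1.trans_lt ((hM n a hn' (hstep a le_rfl)).2 (by omega))))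
end

section
/- Let r ≥ 2 and t ≥ s ≥ 1 be integers with t = s + 1/2 + √(2s + 1/4). Then for every ε > 0 there exist η > 0 and n₀ such that for all n ≥ n₀ and all integers d with 0 ≤ d ≤ n−1: if F_{r,s,t}(⌊(r−1)n/r⌋, n) ≤ F_{r,s,t}(d, n) + η·n^{(r−1)s+t−1}, then d ≥ ((r−1)/r)·n − ε·n. -/
open SimpleGraph

open Finset in
/-- The number of vertex sets meeting the `i`-th colour class in exactly `m i` vertices. -/
theorem card_filter_card_inter_fiber {V : Type*} [Fintype V] [DecidableEq V] {q : ℕ}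
    (c : V → Fin q) (m : Fin q → ℕ) :
    #{S : Finset V | ∀ i, #{v ∈ S | c v = i} = m i} = ∏ i, (#{v | c v = i}).choose (m i) := by
  simp_rw [← card_powersetCard, ← Fintype.card_piFinset]
  refine card_nbij' (fun S i => {v ∈ S | c v = i}) (fun f => univ.biUnion f) ?_ ?_ ?_ ?_
  · intro S hS
    simp only [coe_filter, mem_univ, true_and, Set.mem_ofPred_eq] at hS
    simp only [mem_coe, Fintype.mem_piFinset, mem_powersetCard]
    exact fun i => ⟨filter_subset_filter _ (subset_univ _), hS i⟩
  · intro f hf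
    simp only [mem_coe, Fintype.mem_piFinset, mem_powersetCard] at hf
    simp only [coe_filter, mem_univ, true_and, Set.mem_ofPred_eq]
    intro i
    rw [← (hf i).2]
    congr 1
    ext v
    simp only [mem_filter, mem_biUnion, mem_univ, true_and]
    constructor
    · rintro ⟨⟨j, hj⟩, rfl⟩
      have := (hf j).1 hj
      simp only [mem_filter, mem_univ, true_and] at this
      rwa [this]
    · intro hv
      have := (hf i).1 hv
      simp only [mem_filter, mem_univ, true_and] at this
      exact ⟨⟨i, hv⟩, this⟩
  · intro S _
    ext v
    simp
  · intro f hf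
    simp only [mem_coe, Fintype.mem_piFinset, mem_powersetCard] at hf
    ext i v
    simp only [mem_filter, mem_biUnion, mem_univ, true_and]
    constructor
    · rintro ⟨⟨j, hj⟩, rfl⟩
      have := (hf j).1 hj
      simp only [mem_filter, mem_univ, true_and] at this
      rwa [this]
    · intro hv
      have := (hf i).1 hv
      simp only [mem_filter, mem_univ, true_and] at this
      exact ⟨⟨i, hv⟩, this⟩

/-- In a complete multipartite graph with `q` classes, the parts of a complete `q`-partite
subgraph lie in distinct classes. -/
theorem exists_perm_of_iso {V : Type*} {q : ℕ} {G : SimpleGraph V} {c : V → Fin q}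
    (hG : ∀ v w, G.Adj v w ↔ c v ≠ c w) {f : Fin q → ℕ} (hf : ∀ i, 0 < f i) {H : G.Subgraph}
    (φ : H.coe ≃g completeMultipartiteGraph fun i => Fin (f i)) :
    ∃ σ : Equiv.Perm (Fin q), ∀ v : H.verts, c v = σ (φ v).1 := by
  have hadj : ∀ v w : H.verts, (φ v).1 ≠ (φ w).1 → c v ≠ c w := by
    intro v w h
    have : H.coe.Adj v w := φ.map_rel_iff.1 h
    exact (hG _ _).1 this.adj_sub
  let p : Fin q → H.verts := fun i => φ.symm ⟨i, 0, hf i⟩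
  have hp : ∀ i, (φ (p i)).1 = i := fun i => by simp [p]
  have hinj : Function.Injective fun i => c (p i) := by
    intro i j hij
    by_contra hne
    exact hadj (p i) (p j) (by rwa [hp, hp]) hij
  refine ⟨Equiv.ofBijective _ (Finite.injective_iff_bijective.1 hinj), fun v => ?_⟩
  obtain ⟨i, hi⟩ := (Finite.injective_iff_surjective.1 hinj) (c v)
  have : (φ v).1 = i := by
    by_contra hne
    exact hadj v (p i) (by rwa [hp]) hi.symm
  simp [this, ← hi]

theorem nonempty_iso_iff {V : Type*} [Finite V] {q : ℕ} {G : SimpleGraph V} {c : V → Fin q}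
    (hG : ∀ v w, G.Adj v w ↔ c v ≠ c w) {f : Fin q → ℕ} (hf : ∀ i, 0 < f i) (H : G.Subgraph) :
    Nonempty (H.coe ≃g completeMultipartiteGraph fun i => Fin (f i)) ↔
      H.IsInduced ∧ ∃ σ : Equiv.Perm (Fin q), ∀ i, Nat.card {v : H.verts // c v = i} = f (σ i) := by
  constructor
  · rintro ⟨φ⟩
    obtain ⟨σ, hσ⟩ := exists_perm_of_iso hG hf φ
    refine ⟨?_, σ.symm, fun i => ?_⟩
    · intro v hv w hw h
      have : H.coe.Adj ⟨v, hv⟩ ⟨w, hw⟩ := by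
        rw [← φ.map_rel_iff]
        intro e
        refine (hG _ _).1 h ?_
        rw [hσ ⟨v, hv⟩, hσ ⟨w, hw⟩]
        exact congrArg σ e
      exact this
    · have e : {v : H.verts // c v = i} ≃ {x : Σ i, Fin (f i) // x.1 = σ.symm i} :=
        φ.toEquiv.subtypeEquiv fun v => by
          rw [hσ v, Equiv.eq_symm_apply]
          rfl
      rw [Nat.card_congr (e.trans (Equiv.sigmaSubtype _))]
      simp
  · rintro ⟨hind, σ, hσ⟩
    have e : ∀ i, {v : H.verts // c v = i} ≃ Fin (f (σ i)) := fun i =>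
      Finite.equivFinOfCardEq (hσ i)
    let ψ : H.verts ≃ Σ i, Fin (f i) :=
      (Equiv.sigmaFiberEquiv fun v : H.verts => c v).symm.trans
        ((Equiv.sigmaCongrRight e).trans (Equiv.sigmaCongrLeft (β := fun i => Fin (f i)) σ))
    have hψ : ∀ v, (ψ v).1 = σ (c v) := fun v => rfl
    refine ⟨⟨ψ, fun {v w} => ?_⟩⟩
    change (ψ v).1 ≠ (ψ w).1 ↔ H.Adj v w
    rw [hψ, hψ, σ.injective.ne_iff, ← hG]
    exact ⟨fun h => hind v.2 w.2 h, fun h => h.adj_sub⟩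

open Finset in
theorem copies_completeMultipartite {V : Type*} [Fintype V] [DecidableEq V] {q : ℕ}
    {G : SimpleGraph V} {c : V → Fin q}
    (hG : ∀ v w, G.Adj v w ↔ c v ≠ c w) {f : Fin q → ℕ} (hf : ∀ i, 0 < f i) :
    copies (completeMultipartiteGraph fun i => Fin (f i)) G =
      #{S : Finset V | ∃ σ : Equiv.Perm (Fin q), ∀ i, #{v ∈ S | c v = i} = f (σ i)} := by
  classical
  rw [copies, ← Fintype.card_coe, ← Nat.card_eq_fintype_card]
  have key : ∀ (A : Set V) (i : Fin q),
      Nat.card {v : A // c v = i} = #{v ∈ A.toFinset | c v = i} := by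
    intro A i
    rw [← Fintype.card_coe, ← Nat.card_eq_fintype_card]
    exact Nat.card_congr ((Equiv.subtypeSubtypeEquivSubtypeInter (· ∈ A) (c · = i)).trans
      (Equiv.subtypeEquivRight fun v => by simp))
  refine Nat.card_congr (Equiv.ofBijective (fun H => ⟨H.1.verts.toFinset, ?_⟩) ⟨?_, ?_⟩)
  · obtain ⟨-, σ, hσ⟩ := (nonempty_iso_iff hG hf H.1).1 H.2
    simp only [mem_filter, mem_univ, true_and]
    exact ⟨σ, fun i => by rw [← hσ, key]⟩
  · rintro ⟨H, hH⟩ ⟨K, hK⟩ h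
    simp only [Subtype.mk.injEq, Set.toFinset_inj] at h
    have h1 := ((nonempty_iso_iff hG hf H).1 hH).1
    have h2 := ((nonempty_iso_iff hG hf K).1 hK).1
    obtain rfl : H = K := by rw [← h1.induce_top_verts, ← h2.induce_top_verts, h]
    rfl
  · rintro ⟨S, hS⟩
    simp only [mem_filter, mem_univ, true_and] at hS
    obtain ⟨σ, hσ⟩ := hS
    refine ⟨⟨(⊤ : G.Subgraph).induce S, (nonempty_iso_iff hG hf _).2 ⟨?_, σ, fun i => ?_⟩⟩, ?_⟩
    · intro v hv w hw h
      exact ⟨hv, hw, h⟩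
    · rw [← hσ, key]
      simp
    · simp

theorem Kmulti_eq (q s t : ℕ) : Kmulti q s t =
  completeMultipartiteGraph fun i : Fin q => Fin (if (i : ℕ) = 0 then t else s) := rfl

theorem turanGraph_adj_ofNat (a q : ℕ) [NeZero q] (v w : Fin a) :
    (turanGraph a q).Adj v w ↔ Fin.ofNat q v ≠ Fin.ofNat q w := by
  simp [turanGraph_adj, Fin.ext_iff]

open Finset in
theorem card_ofNat_fiber (a q : ℕ) [NeZero q] (i : Fin q) :
    a / q ≤ #{v : Fin a | Fin.ofNat q v = i} ∧ #{v : Fin a | Fin.ofNat q v = i} ≤ a / q + 1 := by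
  have h : #{v : Fin a | Fin.ofNat q v = i} = a.count (· ≡ i [MOD q]) := by
    rw [Nat.count_eq_card_filter_range]
    refine card_bij (fun v _ => v.val) ?_ (fun v _ w _ h => Fin.ext h) ?_
    · intro v hv
      simpa [Fin.ext_iff, Nat.ModEq, Nat.mod_eq_of_lt i.2] using hv
    · intro x hx
      rw [mem_filter, mem_range] at hx
      exact ⟨⟨x, hx.1⟩, by simpa [Fin.ext_iff, Nat.ModEq, Nat.mod_eq_of_lt i.2] using hx.2, rfl⟩
  rw [h, Nat.count_modEq_card _ (NeZero.pos q)]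
  split_ifs <;> omega

open Finset in
theorem copies_Kmulti_diag_bounds (a q s : ℕ) (hq : 1 ≤ q) (hs : 1 ≤ s) :
    (a / q).choose s ^ q ≤ copies (Kmulti q s s) (turanGraph a q) ∧
      copies (Kmulti q s s) (turanGraph a q) ≤ (a / q + 1).choose s ^ q := by
  have : NeZero q := ⟨by omega⟩
  rw [Kmulti_eq, copies_completeMultipartite (turanGraph_adj_ofNat a q) (by intro i; simpa)]
  simp only [ite_self, exists_const]
  rw [card_filter_card_inter_fiber _ fun _ => s]
  constructor
  · have := pow_card_le_prod univ _ _ fun i _ =>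
      Nat.choose_le_choose s (card_ofNat_fiber a q i).1
    rwa [card_univ, Fintype.card_fin] at this
  · have := prod_le_pow_card univ _ _ fun i _ =>
      Nat.choose_le_choose s (card_ofNat_fiber a q i).2
    rwa [card_univ, Fintype.card_fin] at this

open Finset in
theorem copies_Kmulti_bounds (a q s t : ℕ) (hq : 1 ≤ q) (hs : 1 ≤ s) (ht : s < t) :
    q * ((a / q).choose s ^ (q - 1) * (a / q).choose t) ≤
        copies (Kmulti q s t) (turanGraph a q) ∧
      copies (Kmulti q s t) (turanGraph a q) ≤
        q * ((a / q + 1).choose s ^ (q - 1) * (a / q + 1).choose t) := by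
  have : NeZero q := ⟨by omega⟩
  rw [Kmulti_eq, copies_completeMultipartite (turanGraph_adj_ofNat a q)
    (by intro i; split_ifs <;> omega)]
  have hset : ({S : Finset (Fin a) | ∃ σ : Equiv.Perm (Fin q), ∀ i,
      #{v ∈ S | Fin.ofNat q (Fin.val v) = i} = if (σ i : ℕ) = 0 then t else s} : Finset _) =
      univ.biUnion fun j : Fin q => {S : Finset (Fin a) | ∀ i,
        #{v ∈ S | Fin.ofNat q (Fin.val v) = i} = if i = j then t else s} := by
    ext S
    simp only [mem_filter, mem_univ, true_and, mem_biUnion]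
    constructor
    · rintro ⟨σ, hσ⟩
      refine ⟨σ.symm 0, fun i => ?_⟩
      rw [hσ]
      congr 1
      rw [Equiv.eq_symm_apply, Fin.ext_iff]
      simp
    · rintro ⟨j, hj⟩
      refine ⟨Equiv.swap j 0, fun i => ?_⟩
      rw [hj]
      congr 1
      rw [← Equiv.apply_eq_iff_eq (Equiv.swap j 0), Equiv.swap_apply_left, Fin.ext_iff]
      simp
  rw [hset, card_biUnion]
  · have hprod : ∀ (b : ℕ) (j : Fin q),
        ∏ i, b.choose (if i = j then t else s) = b.choose s ^ (q - 1) * b.choose t := by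
      intro b j
      rw [← mul_prod_erase _ _ (mem_univ j), if_pos rfl, mul_comm]
      congr 1
      rw [prod_congr rfl fun i hi => by rw [if_neg (ne_of_mem_erase hi)]]
      simp
    have hc : ∀ x : ℕ, q * x = ∑ _j : Fin q, x := by simp
    simp_rw [hc, card_filter_card_inter_fiber]
    constructor
    · refine sum_le_sum fun j _ => ?_
      rw [← hprod _ j]
      exact prod_le_prod' fun i _ => Nat.choose_le_choose _ (card_ofNat_fiber a q i).1
    · refine sum_le_sum fun j _ => ?_
      rw [← hprod _ j]
      exact prod_le_prod' fun i _ => Nat.choose_le_choose _ (card_ofNat_fiber a q i).2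
  · intro j _ j' _ hne
    rw [Function.onFun, disjoint_filter]
    intro S _ h1 h2
    have := h1 j
    rw [h2 j, if_pos rfl, if_neg hne] at this
    omega


theorem quadruple_poly_pos (k : ℕ) (hk : 2 ≤ k) (u : ℝ) (hu : 1 < u) :
    0 < k * u ^ (k + 1) - (k + 2) * u ^ k + k * u - (k - 2) := by
  induction k, hk using Nat.le_induction with
  | base =>
    have : 0 < u * (u - 1) ^ 2 := by have := sub_pos.2 hu; positivity
    norm_num
    nlinarith
  | succ k hk ih =>
    have hB := one_add_mul_le_pow (a := u - 1) (by linarith) (k + 1)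
    have h1 : 0 < u * (k * u ^ (k + 1) - (k + 2) * u ^ k + k * u - (k - 2)) :=
      mul_pos (by linarith) ih
    have h2 : 0 ≤ (u - 1) * (u ^ (k + 1) - k * u + k - 1) := by
      refine mul_nonneg (by linarith) ?_
      have e : 1 + (u - 1) = u := by ring
      rw [e] at hB
      push_cast at hB
      linarith
    push_cast
    ring_nf at h1 h2 ⊢
    linarith

theorem params_of_sqrt (s t : ℕ) (hs : 1 ≤ s)
    (ht : (t : ℝ) = s + 1 / 2 + Real.sqrt (2 * s + 1 / 4)) :
    ∃ k : ℕ, 2 ≤ k ∧ t = s + k ∧ 2 * s + k = k * k := by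
  have h1 : (1 / 2 : ℝ) ≤ Real.sqrt (2 * s + 1 / 4) := Real.le_sqrt_of_sq_le (by
    have : (0 : ℝ) ≤ s := by positivity
    norm_num)
  have hsq := Real.sq_sqrt (show (0 : ℝ) ≤ 2 * s + 1 / 4 by positivity)
  have hle : s ≤ t := by
    have : (s : ℝ) ≤ t := by linarith
    exact_mod_cast this
  obtain ⟨k, rfl⟩ := Nat.exists_eq_add_of_le hle
  have h2 : Real.sqrt (2 * s + 1 / 4) = k - 1 / 2 := by push_cast at ht; linarith
  have h3 : 2 * s + k = k * k := by
    rw [h2] at hsq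
    have : (2 * s + k : ℝ) = k * k := by linarith
    exact_mod_cast this
  refine ⟨k, ?_, rfl, h3⟩
  by_contra hk
  interval_cases k <;> omega

/-- Up to the factor `s!^q t!`, the leading form of `Fval (q + 1) s t`, when the `q` parts of the
Turán graph have size `y` and the remaining part has size `z`. -/
noncomputable def profile (q s t : ℕ) (y z : ℝ) : ℝ :=
  q * s * z ^ (s - 1) * y ^ ((q - 1) * s + t) + t * z ^ (t - 1) * y ^ (q * s)

theorem profile_smul (q s t : ℕ) (hq : 1 ≤ q) (hs : 1 ≤ s) (ht : 1 ≤ t) (c y z : ℝ) :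
    profile q s t (c * y) (c * z) = c ^ (q * s + t - 1) * profile q s t y z := by
  obtain ⟨q, rfl⟩ := Nat.exists_eq_add_of_le' hq
  obtain ⟨s, rfl⟩ := Nat.exists_eq_add_of_le' hs
  obtain ⟨t, rfl⟩ := Nat.exists_eq_add_of_le' ht
  have e : (q + 1) * (s + 1) + (t + 1) - 1 = s + (q * (s + 1) + (t + 1)) := by
    have : (q + 1) * (s + 1) = q * (s + 1) + (s + 1) := by ring
    omega
  simp only [profile, Nat.add_sub_cancel, mul_pow]
  rw [mul_add]
  rw [e, pow_add]
  ring

theorem profile_diag (q s t : ℕ) (hq : 1 ≤ q) (hs : 1 ≤ s) (ht : 1 ≤ t) (w : ℝ) :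
    profile q s t w w = (q * s + t) * w ^ (q * s + t - 1) := by
  have := profile_smul q s t hq hs ht w 1 1
  simp only [mul_one] at this
  rw [this]
  simp [profile]
  ring

theorem profile_strictMonoOn (q s t k : ℕ) (hq : 1 ≤ q) (hs : 1 ≤ s) (hk : 2 ≤ k)
    (ht : t = s + k) (hsk : 2 * s + k = k * k) :
    StrictMonoOn (fun y : ℝ => profile q s t y (1 - q * y)) (Set.Ioc 0 (1 / (q + 1))) := by
  have hqR : (1 : ℝ) ≤ q := by exact_mod_cast hq
  have hsR : (1 : ℝ) ≤ s := by exact_mod_cast hs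
  have hkR : (2 : ℝ) ≤ k := by exact_mod_cast hk
  have hz : ∀ y ∈ Set.Ioc (0 : ℝ) (1 / (q + 1)), 0 < y ∧ y ≤ 1 - q * y := by
    rintro y ⟨h0, h1⟩
    rw [le_div_iff₀ (by positivity)] at h1
    exact ⟨h0, by linarith⟩
  set L : ℝ → ℝ := fun y => (q * s : ℕ) * Real.log y + (s - 1 : ℕ) * Real.log (1 - q * y) +
    Real.log (q * s * y ^ k + t * (1 - q * y) ^ k) with hL
  have hfac : ∀ y : ℝ, profile q s t y (1 - q * y) =
      y ^ (q * s) * (1 - q * y) ^ (s - 1) * (q * s * y ^ k + t * (1 - q * y) ^ k) := by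
    intro y
    obtain ⟨q, rfl⟩ := Nat.exists_eq_add_of_le' hq
    obtain ⟨s, rfl⟩ := Nat.exists_eq_add_of_le' hs
    subst ht
    simp only [profile, Nat.add_sub_cancel]
    rw [show s + 1 + k - 1 = s + k by omega,
      show q * (s + 1) + (s + 1 + k) = (q + 1) * (s + 1) + k by ring, pow_add, pow_add]
    ring
  have hexp : ∀ y ∈ Set.Ioc (0 : ℝ) (1 / (q + 1)),
      profile q s t y (1 - q * y) = Real.exp (L y) := by
    intro y hy
    obtain ⟨h0, h1⟩ := hz y hy
    have hz0 : 0 < 1 - q * y := h0.trans_le h1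
    rw [hfac, hL, Real.exp_add, Real.exp_add, Real.exp_log (by positivity), Real.exp_nat_mul,
      Real.exp_nat_mul, Real.exp_log h0, Real.exp_log hz0]
  have hder : ∀ y ∈ Set.Ioc (0 : ℝ) (1 / (q + 1)), HasDerivAt L
      ((q * s : ℕ) * (1 / y) + (s - 1 : ℕ) * ((-q) / (1 - q * y)) +
        (q * s * (k * y ^ (k - 1)) + t * (k * (1 - q * y) ^ (k - 1) * (-q))) /
          (q * s * y ^ k + t * (1 - q * y) ^ k)) y := by
    intro y hy
    obtain ⟨h0, h1⟩ := hz y hy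
    have hz0 : 0 < 1 - q * y := h0.trans_le h1
    have hlin : HasDerivAt (fun y : ℝ => 1 - q * y) (-q) y := by
      simpa using ((hasDerivAt_id y).const_mul (q : ℝ)).const_sub 1
    have hB : HasDerivAt (fun y : ℝ => q * s * y ^ k + t * (1 - q * y) ^ k)
        (q * s * (k * y ^ (k - 1)) + t * (k * (1 - q * y) ^ (k - 1) * (-q))) y :=
      ((hasDerivAt_pow k y).const_mul _).add ((hlin.pow k).const_mul _)
    have hl : HasDerivAt Real.log (1 / y) y := by
      simpa using Real.hasDerivAt_log h0.ne'
    exact ((hl.const_mul _).add ((hlin.log hz0.ne').const_mul _)).add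
      (hB.log (by positivity))
  have hmono : StrictMonoOn L (Set.Ioc 0 (1 / (q + 1))) := by
    refine strictMonoOn_of_deriv_pos (convex_Ioc _ _)
      (fun y hy => (hder y hy).continuousAt.continuousWithinAt) ?_
    intro y hy
    rw [interior_Ioc] at hy
    rw [(hder y ⟨hy.1, hy.2.le⟩).deriv]
    have h0 : 0 < y := hy.1
    have h1 : y < 1 - q * y := by
      have := hy.2
      rw [lt_div_iff₀ (by positivity)] at this
      linarith
    generalize 1 - q * y = z at h1
    have hz0 : 0 < z := h0.trans h1
    have hP := quadruple_poly_pos k hk (z / y) (by rwa [one_lt_div h0])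
    have hP' : 0 < k * z ^ (k + 1) - (k + 2) * z ^ k * y + k * z * y ^ k -
        (k - 2) * y ^ (k + 1) := by
      have := mul_pos hP (pow_pos h0 (k + 1))
      refine this.trans_eq ?_
      rw [div_pow, div_pow]
      field_simp
      ring
    have hs2 : (s : ℝ) = (k * k - k) / 2 := by
      have : (2 * s + k : ℝ) = k * k := by exact_mod_cast hsk
      linarith
    have htR : (t : ℝ) = (k * k + k) / 2 := by
      rw [ht]; push_cast; rw [hs2]; ring
    obtain ⟨j, rfl⟩ : ∃ j, k = j + 1 := ⟨k - 1, by omega⟩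
    rw [Nat.cast_sub hs]
    simp only [Nat.add_sub_cancel]
    push_cast at hP' hs2 htR hkR ⊢
    have hnum : 0 < q * (s * z * (q * s * y ^ (j + 1) + t * z ^ (j + 1))
        - (s - 1) * y * (q * s * y ^ (j + 1) + t * z ^ (j + 1))
        + (j + 1) * y * z * (s * y ^ j - t * z ^ j)) := by
      refine mul_pos (by positivity) ?_
      have h3 : 0 ≤ (q - 1 : ℝ) * (s * y ^ (j + 1) * (s * z - (s - 1) * y)) := by
        have : 0 ≤ s * z - (s - 1) * y := by nlinarith
        have : (0 : ℝ) ≤ q - 1 := by linarith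
        positivity
      have h4 : 0 < (s : ℝ) * (j + 2) / 2 * ((j + 1) * z ^ (j + 1 + 1) -
          (j + 1 + 2) * z ^ (j + 1) * y + (j + 1) * z * y ^ (j + 1) -
          (j + 1 - 2) * y ^ (j + 1 + 1)) := by
        positivity
      have := add_pos_of_nonneg_of_pos h3 h4
      convert this using 1
      rw [hs2, htR]
      ring
    have htp : 0 < (t : ℝ) := by rw [htR]; positivity
    have hB : 0 < q * s * y ^ (j + 1) + t * z ^ (j + 1) := by positivity
    have := div_pos hnum (mul_pos (mul_pos h0 hz0) hB)
    refine this.trans_eq ?_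
    field_simp
    ring
  intro a ha b hb hab
  simp only [hexp a ha, hexp b hb]
  exact Real.exp_lt_exp.2 (hmono ha hb hab)

theorem pow_div_factorial_le_choose {w : ℝ} (hw : 0 ≤ w) (m j : ℕ) (h : w + j ≤ m + 1) :
    w ^ j / (j.factorial : ℝ) ≤ m.choose j := by
  refine le_trans ?_ (Nat.pow_le_choose j m)
  have hj : j ≤ m + 1 := by
    have : (j : ℝ) ≤ m + 1 := by linarith
    exact_mod_cast this
  gcongr
  rw [Nat.cast_sub hj]
  push_cast
  linarith

theorem choose_le_pow_div_factorial {w : ℝ} (m j : ℕ) (h : m ≤ w) :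
    (m.choose j : ℝ) ≤ w ^ j / (j.factorial : ℝ) :=
  (Nat.choose_le_pow_div j m).trans (by gcongr)

theorem profile_div_eq (q s t : ℕ) (hq : 1 ≤ q) (hs : 1 ≤ s) (ht : 1 ≤ t) (y z : ℝ) :
    profile q s t y z / ((s.factorial : ℝ) ^ q * t.factorial) =
      z ^ (s - 1) / ((s - 1).factorial : ℝ) * (q * ((y ^ s / (s.factorial : ℝ)) ^ (q - 1) *
        (y ^ t / (t.factorial : ℝ)))) +
      z ^ (t - 1) / ((t - 1).factorial : ℝ) * (y ^ s / (s.factorial : ℝ)) ^ q := by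
  obtain ⟨q, rfl⟩ := Nat.exists_eq_add_of_le' hq
  obtain ⟨s, rfl⟩ := Nat.exists_eq_add_of_le' hs
  obtain ⟨t, rfl⟩ := Nat.exists_eq_add_of_le' ht
  simp only [profile, Nat.add_sub_cancel, Nat.factorial_succ, div_pow, ← pow_mul]
  have h1 : (s.factorial : ℝ) ≠ 0 := by positivity
  have h2 : (t.factorial : ℝ) ≠ 0 := by positivity
  push_cast
  rw [show (s + 1) * (q + 1) = (q + 1) * (s + 1) by ring, pow_add,
    show (s + 1) * q = q * (s + 1) by ring]
  simp only [pow_succ (_ * _ : ℝ) q]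
  field_simp

theorem Fval_le_profile (q s t d n : ℕ) (hq : 1 ≤ q) (hs : 1 ≤ s) (ht : s < t) (hd : d ≤ n) :
    Fval (q + 1) s t d n ≤
      profile q s t (d / q + 1) (n - d) / ((s.factorial : ℝ) ^ q * t.factorial) := by
  rw [profile_div_eq q s t hq hs (by omega), Fval, if_neg ht.ne, one_mul, Nat.add_sub_cancel]
  have h1 : ((n - 1 - d : ℕ) : ℝ) ≤ n - d := by
    rw [← Nat.cast_sub hd]
    exact_mod_cast (by omega : n - 1 - d ≤ n - d)
  have h2 : ((d / q + 1 : ℕ) : ℝ) ≤ (d : ℝ) / q + 1 := by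
    push_cast
    gcongr
    exact Nat.cast_div_le
  have c1 := (copies_Kmulti_bounds d q s t hq hs ht).2
  have c2 := (copies_Kmulti_diag_bounds d q s hq hs).2
  have c1' : (copies (Kmulti q s t) (turanGraph d q) : ℝ) ≤
      q * (((d / q + 1).choose s : ℝ) ^ (q - 1) * (d / q + 1).choose t) := by exact_mod_cast c1
  have c2' : (copies (Kmulti q s s) (turanGraph d q) : ℝ) ≤
      ((d / q + 1).choose s : ℝ) ^ q := by exact_mod_cast c2
  have h0 : (0 : ℝ) ≤ n - d := le_trans (by positivity) h1
  have c3 := choose_le_pow_div_factorial _ s h2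
  have c4 := choose_le_pow_div_factorial _ t h2
  refine add_le_add (mul_le_mul (choose_le_pow_div_factorial _ _ h1) (c1'.trans ?_)
    (by positivity) (by positivity)) (mul_le_mul (choose_le_pow_div_factorial _ _ h1)
      (c2'.trans ?_) (by positivity) (by positivity)) <;> gcongr

theorem profile_le_Fval (q s t a n : ℕ) (hq : 1 ≤ q) (hs : 1 ≤ s) (ht : s < t) {w : ℝ}
    (hw : 0 ≤ w) (h1 : w + t ≤ (a / q : ℕ) + 1) (h2 : w + t ≤ (n - 1 - a : ℕ) + 1) :
    profile q s t w w / ((s.factorial : ℝ) ^ q * t.factorial) ≤ Fval (q + 1) s t a n := by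
  rw [profile_div_eq q s t hq hs (by omega), Fval, if_neg ht.ne, one_mul, Nat.add_sub_cancel]
  have c1 := (copies_Kmulti_bounds a q s t hq hs ht).1
  have c2 := (copies_Kmulti_diag_bounds a q s hq hs).1
  have c1' : q * (((a / q).choose s : ℝ) ^ (q - 1) * (a / q).choose t) ≤
      (copies (Kmulti q s t) (turanGraph a q) : ℝ) := by exact_mod_cast c1
  have c2' : ((a / q).choose s : ℝ) ^ q ≤
      (copies (Kmulti q s s) (turanGraph a q) : ℝ) := by exact_mod_cast c2
  have hle : ∀ j ≤ t, (j : ℝ) ≤ t := fun j hj => by exact_mod_cast hj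
  have c3 := pow_div_factorial_le_choose hw (a / q) s (by linarith [hle s ht.le])
  have c4 := pow_div_factorial_le_choose hw (a / q) t h1
  refine add_le_add (mul_le_mul (pow_div_factorial_le_choose hw _ _ (by
    linarith [hle (s - 1) (by omega)])) (le_trans ?_ c1') (by positivity) (by positivity))
    (mul_le_mul (pow_div_factorial_le_choose hw _ _ (by linarith [hle (t - 1) (by omega)]))
      (le_trans ?_ c2') (by positivity) (by positivity)) <;> gcongr

open Filter Topology in
theorem statement14 (r s t : ℕ) (hr : 2 ≤ r) (hs : 1 ≤ s) (hst : s ≤ t)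
    (ht : (t : ℝ) = s + 1 / 2 + Real.sqrt (2 * s + 1 / 4)) :
    ∀ ε : ℝ, 0 < ε → ∃ (η : ℝ) (n₀ : ℕ), 0 < η ∧ ∀ n ≥ n₀, ∀ d : ℕ, d ≤ n - 1 →
      Fval r s t ((r - 1) * n / r) n
          ≤ Fval r s t d n + η * (n : ℝ) ^ ((r - 1) * s + t - 1) →
      ((r : ℝ) - 1) / r * n - ε * n ≤ (d : ℝ) := by
  intro ε hε
  obtain ⟨k, hk, htk, hsk⟩ := params_of_sqrt s t hs ht
  obtain ⟨q, rfl⟩ : ∃ q, r = q + 1 := ⟨r - 1, by omega⟩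
  have hq : 1 ≤ q := by omega
  have hq0 : (0 : ℝ) < q := by exact_mod_cast hq
  have hlt : s < t := by omega
  rw [Nat.add_sub_cancel]
  set N := q * s + t - 1 with hN
  set c : ℝ := (s.factorial : ℝ) ^ q * t.factorial with hc
  have hc0 : 0 < c := by positivity
  set y₀ : ℝ := max (1 / (q + 1) - ε / (2 * q)) (1 / (2 * (q + 1))) with hy₀
  have hy₀pos : 0 < y₀ := lt_max_of_lt_right (by positivity)
  have hy₀lt : y₀ < 1 / (q + 1) := by
    refine max_lt ?_ ?_
    · have : 0 < ε / (2 * q) := by positivity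
      linarith
    · exact one_div_lt_one_div_of_lt (by positivity) (by linarith)
  have hmono := profile_strictMonoOn q s t k hq hs hk htk hsk
  set m := profile q s t y₀ (1 - q * y₀) with hm
  set M : ℝ := (q * s + t) * (1 / (q + 1)) ^ N with hM
  have hmM : m < M := by
    have := hmono ⟨hy₀pos, hy₀lt.le⟩ ⟨by positivity, le_rfl⟩ hy₀lt
    simp only at this
    rwa [show (1 : ℝ) - q * (1 / (q + 1)) = 1 / (q + 1) by field_simp; ring,
      profile_diag q s t hq hs (by omega)] at this
  set η : ℝ := (M - m) / (2 * c) with hη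
  have hη0 : 0 < η := div_pos (by linarith) (by positivity)
  set C : ℝ := t + 2 with hC
  have hinv : Tendsto (fun n : ℕ => ((n : ℝ))⁻¹) atTop (𝓝 0) := tendsto_inv_atTop_nhds_zero_nat
  have hlow : Tendsto (fun n : ℕ => (q * s + t) * (1 / (q + 1) - C * (n : ℝ)⁻¹) ^ N) atTop
      (𝓝 M) := by
    simpa [hM] using (((hinv.const_mul C).const_sub (1 / (q + 1) : ℝ)).pow N).const_mul (q * s + t : ℝ)
  have hupp : Tendsto (fun n : ℕ => (1 + q * (n : ℝ)⁻¹) ^ N * m + η * c) atTop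
      (𝓝 (m + η * c)) := by
    simpa using ((((hinv.const_mul (q : ℝ)).const_add 1).pow N).mul_const m).add_const (η * c)
  have hgap : m + η * c < M := by
    have : η * c = (M - m) / 2 := by rw [hη]; field_simp
    linarith
  have hev := hupp.eventually_lt hlow hgap
  obtain ⟨n₁, hn₁⟩ := eventually_atTop.1 hev
  obtain ⟨n₂, hn₂⟩ := exists_nat_ge (2 * q / ε)
  obtain ⟨n₃, hn₃⟩ := exists_nat_ge (C * (q + 1))
  refine ⟨η, max 1 (max n₁ (max n₂ n₃)), hη0, fun n hn d hd hF => ?_⟩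
  simp only [ge_iff_le, max_le_iff] at hn
  obtain ⟨hn1, hna, hnb, hnc⟩ := hn
  have hnR : (0 : ℝ) < n := by exact_mod_cast hn1
  by_contra! hcon
  push_cast at hcon
  have hn₂' : 2 * q / ε ≤ n := hn₂.trans (by exact_mod_cast hnb)
  have hn₃' : C * (q + 1) ≤ n := hn₃.trans (by exact_mod_cast hnc)
  have hupper : Fval (q + 1) s t d n ≤ (n + q) ^ N * m / c := by
    refine (Fval_le_profile q s t d n hq hs hlt (by omega)).trans ?_
    set y : ℝ := (d / q + 1) / (n + q) with hy
    have hy0 : 0 < y := by positivity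
    have hyle : y ≤ y₀ := by
      refine le_trans ?_ (le_max_left _ _)
      have h1 : y ≤ (d / q + 1) / n := by rw [hy]; gcongr; linarith
      refine h1.trans ?_
      rw [div_le_iff₀ hnR]
      rw [div_le_iff₀ hε] at hn₂'
      have h2 : (d : ℝ) / q ≤ (1 / (q + 1) - ε / q) * n := by
        rw [div_le_iff₀ hq0]
        refine hcon.le.trans_eq ?_
        field_simp
        ring
      have h3 : 1 ≤ ε / (2 * q) * n := by
        rw [div_mul_eq_mul_div, le_div_iff₀ (by positivity)]
        linarith
      have h4 : ε / q = 2 * (ε / (2 * q)) := by field_simp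
      rw [h4] at h2
      linarith
    have e1 : (d : ℝ) / q + 1 = (n + q) * y := by rw [hy]; field_simp
    have e2 : (n : ℝ) - d = (n + q) * (1 - q * y) := by rw [hy]; field_simp; ring
    rw [e1, e2, profile_smul q s t hq hs (by omega)]
    have := hmono.monotoneOn ⟨hy0, hyle.trans hy₀lt.le⟩ ⟨hy₀pos, hy₀lt.le⟩ hyle
    gcongr
  have hlower : (q * s + t) * ((n : ℝ) / (q + 1) - C) ^ N / c ≤
      Fval (q + 1) s t (q * n / (q + 1)) n := by
    rw [← profile_diag q s t hq hs (by omega)]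
    have hw : 0 ≤ (n : ℝ) / (q + 1) - C := by
      rw [sub_nonneg, le_div_iff₀ (by positivity)]
      exact hn₃'
    set a := q * n / (q + 1) with ha
    have ha1 : a * (q + 1) ≤ q * n := Nat.div_mul_le_self _ _
    have ha2 : q * n < (a + 1) * (q + 1) := Nat.lt_mul_of_div_lt (Nat.lt_succ_self _) (by omega)
    have ha1' : (a : ℝ) * (q + 1) ≤ q * n := by exact_mod_cast ha1
    have ha2' : (q * n : ℝ) < (a + 1) * (q + 1) := by exact_mod_cast ha2
    refine profile_le_Fval q s t a n hq hs hlt hw ?_ ?_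
    · have hb : a < (a / q + 1) * q := Nat.lt_mul_of_div_lt (Nat.lt_succ_self _) (by omega)
      have hb' : (a + 1 : ℝ) ≤ ((a / q : ℕ) + 1) * q := by exact_mod_cast hb
      have h5 : (n : ℝ) / (q + 1) ≤ (a / q : ℕ) + 1 := by
        rw [div_le_iff₀ (by positivity)]
        have : (q * n : ℝ) ≤ q * (((a / q : ℕ) + 1) * (q + 1)) := by nlinarith
        exact le_of_mul_le_mul_left this hq0
      linarith
    · have han : (a : ℝ) ≤ n - n / (q + 1) := by
        have : (n : ℝ) - n / (q + 1) = q * n / (q + 1) := by field_simp; ring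
        rw [this, le_div_iff₀ (by positivity)]
        exact ha1'
      have : ((n : ℝ) - a) ≤ (n - 1 - a : ℕ) + 1 := by
        have : n ≤ (n - 1 - a) + 1 + a := by omega
        have : (n : ℝ) ≤ (n - 1 - a : ℕ) + 1 + a := by exact_mod_cast this
        linarith
      linarith
  have hfin := hn₁ n hna
  have hchain := hlower.trans (hF.trans (add_le_add_left hupper _))
  have hl : (n : ℝ) / (q + 1) - C = n * (1 / (q + 1) - C * (n : ℝ)⁻¹) := by field_simp
  have hu : (n : ℝ) + q = n * (1 + q * (n : ℝ)⁻¹) := by field_simp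
  rw [hl, hu, mul_pow, mul_pow] at hchain
  have hscaled := mul_lt_mul_of_pos_left hfin (pow_pos hnR N)
  rw [div_add' _ _ _ hc0.ne', div_le_div_iff_of_pos_right hc0] at hchain
  linarith
end

section
/- Let r ≥ 2 and t ≥ s ≥ 1 be integers with t ≤ s + 1/2 + √(2s + 1/4). For every ε > 0 there exists n₀ such that for all n ≥ n₀: if G is an n-vertex r-partite graph attaining the maximum of N(·, K^{(r)}_{s,t}) over all n-vertex r-partite graphs, then G is a complete r-partite graph each of whose parts has size between (1/r − ε)n and (1/r + ε)n. Moreover, if additionally t < s + 1/2 + √(2s + 1/4), then there exists n₁ such that for all n ≥ n₁ the unique such maximizer is the Turán graph T_r(n). -/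
open SimpleGraph

/-- `G` is `r`-partite: its vertex set can be partitioned into `r` independent sets. -/
def IsMultipartite {V : Type*} (r : ℕ) (G : SimpleGraph V) : Prop :=
  ∃ f : V → Fin r, ∀ v w, G.Adj v w → f v ≠ f w

open Finset in
/-- The falling factorial `x (x - 1) ⋯ (x - d + 1)` of a real number. -/
noncomputable def fallingFactorial (d : ℕ) (x : ℝ) : ℝ := ∏ k ∈ range d, (x - k)

lemma fallingFactorial_succ (d : ℕ) (x : ℝ) :
    fallingFactorial (d + 1) x = (x - d) * fallingFactorial d x := by
  rw [fallingFactorial, Finset.prod_range_succ, mul_comm, fallingFactorial]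

lemma mul_fallingFactorial_sub_one (d : ℕ) (x : ℝ) :
    x * fallingFactorial d (x - 1) = (x - d) * fallingFactorial d x := by
  rw [← fallingFactorial_succ, fallingFactorial, fallingFactorial, Finset.prod_range_succ',
    mul_comm]
  congr 1
  · exact Finset.prod_congr rfl fun k _ => by push_cast; ring
  · simp

lemma fallingFactorial_natCast (d m : ℕ) :
    fallingFactorial d (m : ℝ) = (m.descFactorial d : ℝ) := by
  induction d with
  | zero => simp [fallingFactorial]
  | succ d ih =>
    rw [fallingFactorial_succ, ih, Nat.descFactorial_succ]
    rcases le_or_gt d m with h | h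
    · push_cast [Nat.cast_sub h]; ring
    · simp [Nat.descFactorial_eq_zero_iff_lt.2 h]

lemma pow_sub_pow_mul_le (d : ℕ) {N u w : ℝ} (hw : 0 ≤ w) (hwu : w ≤ u) (hu : u ≤ N) :
    (u ^ d - w ^ d) * N ≤ d * (u - w) * N ^ d := by
  induction d with
  | zero => simp
  | succ d ih =>
    have hN : 0 ≤ N := by linarith
    have h1 : w ^ d ≤ N ^ d := pow_le_pow_left₀ hw (hwu.trans hu) d
    have h2 : w ^ d ≤ u ^ d := pow_le_pow_left₀ hw hwu d
    have h3 : u * ((u ^ d - w ^ d) * N) ≤ N * (d * (u - w) * N ^ d) :=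
      mul_le_mul hu ih (mul_nonneg (by linarith) hN) hN
    have h4 : (u - w) * w ^ d * N ≤ (u - w) * N ^ d * N := by
      gcongr
    calc (u ^ (d + 1) - w ^ (d + 1)) * N
        = u * ((u ^ d - w ^ d) * N) + (u - w) * w ^ d * N := by ring
      _ ≤ N * (d * (u - w) * N ^ d) + (u - w) * N ^ d * N := add_le_add h3 h4
      _ = _ := by push_cast; ring

/-- The lower order part of the falling factorial is bounded, and Lipschitz, with constants of
lower order. -/
lemma exists_fallingFactorial_sub_pow_bound (d : ℕ) :
    ∃ C : ℝ, 0 ≤ C ∧ ∀ N u w : ℝ, 1 ≤ N → 0 ≤ w → w ≤ u → u ≤ N →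
      |fallingFactorial d u - u ^ d| * N ≤ C * N ^ d ∧
      |fallingFactorial d w - w ^ d| * N ≤ C * N ^ d ∧
      |(fallingFactorial d u - u ^ d) - (fallingFactorial d w - w ^ d)| * N ^ 2
        ≤ C * (u - w) * N ^ d := by
  induction d with
  | zero =>
    refine ⟨0, le_rfl, fun N u w _ _ _ _ => ?_⟩
    simp [fallingFactorial]
  | succ d ih =>
    obtain ⟨C, hC, h⟩ := ih
    refine ⟨(d + 1) * d + (d + 2) * C, by positivity, fun N u w hN hw hwu hu => ?_⟩
    obtain ⟨h1, h2, h3⟩ := h N u w hN hw hwu hu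
    have hN0 : 0 < N := by linarith
    have key : ∀ x, fallingFactorial (d + 1) x - x ^ (d + 1)
        = (x - d) * (fallingFactorial d x - x ^ d) - d * x ^ d := fun x => by
      rw [fallingFactorial_succ]; ring
    have bd : ∀ x, 0 ≤ x → x ≤ N → |x - d| ≤ (d + 1) * N := fun x hx hxN => by
      rw [abs_le]
      have : (d : ℝ) ≤ d * N := le_mul_of_one_le_right (by positivity) hN
      constructor <;> nlinarith
    have one : ∀ x, 0 ≤ x → x ≤ N → |fallingFactorial d x - x ^ d| * N ≤ C * N ^ d →
        |fallingFactorial (d + 1) x - x ^ (d + 1)| * N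
          ≤ ((d + 1) * d + (d + 2) * C) * N ^ (d + 1) := fun x hx hxN hx' => by
      rw [key]
      have e1 : |(x - d) * (fallingFactorial d x - x ^ d) - d * x ^ d|
          ≤ (d + 1) * N * |fallingFactorial d x - x ^ d| + d * x ^ d := by
        refine (abs_sub _ _).trans ?_
        rw [abs_mul, abs_of_nonneg (by positivity : (0:ℝ) ≤ d * x ^ d)]
        gcongr
        exact bd x hx hxN
      have e2 : x ^ d ≤ N ^ d := pow_le_pow_left₀ hx hxN d
      calc _ ≤ ((d + 1) * N * |fallingFactorial d x - x ^ d| + d * x ^ d) * N := by gcongr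
        _ = (d + 1) * N * (|fallingFactorial d x - x ^ d| * N) + d * x ^ d * N := by ring
        _ ≤ (d + 1) * N * (C * N ^ d) + d * N ^ d * N := by gcongr
        _ ≤ (d + 1) * N * (C * N ^ d) + d * N ^ d * N + (d ^ 2 + C) * N ^ (d + 1) :=
            le_add_of_nonneg_right (by positivity)
        _ = _ := by ring
    refine ⟨one u (hw.trans hwu) hu h1, one w hw (hwu.trans hu) h2, ?_⟩
    rw [key, key]
    set a := fallingFactorial d u - u ^ d
    set b := fallingFactorial d w - w ^ d
    have e0 : (u - d) * a - d * u ^ d - ((w - d) * b - d * w ^ d)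
        = (u - d) * (a - b) + (u - w) * b - d * (u ^ d - w ^ d) := by ring
    have e1 : 0 ≤ u ^ d - w ^ d := sub_nonneg.2 (pow_le_pow_left₀ hw hwu d)
    have e2 : |(u - d) * (a - b) + (u - w) * b - d * (u ^ d - w ^ d)|
        ≤ (d + 1) * N * |a - b| + (u - w) * |b| + d * (u ^ d - w ^ d) := by
      refine (abs_sub _ _).trans ?_
      rw [abs_of_nonneg (by positivity : (0:ℝ) ≤ d * (u ^ d - w ^ d))]
      gcongr
      refine (abs_add_le _ _).trans ?_
      rw [abs_mul, abs_mul, abs_of_nonneg (sub_nonneg.2 hwu)]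
      gcongr
      exact bd u (hw.trans hwu) hu
    have e3 := pow_sub_pow_mul_le d hw hwu hu
    have e4 : 0 ≤ u - w := sub_nonneg.2 hwu
    rw [e0]
    calc _ ≤ ((d + 1) * N * |a - b| + (u - w) * |b| + d * (u ^ d - w ^ d)) * N ^ 2 := by gcongr
      _ = (d + 1) * N * (|a - b| * N ^ 2) + (u - w) * N * (|b| * N)
          + d * N * ((u ^ d - w ^ d) * N) := by ring
      _ ≤ (d + 1) * N * (C * (u - w) * N ^ d) + (u - w) * N * (C * N ^ d)
          + d * N * (d * (u - w) * N ^ d) := by gcongr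
      _ ≤ (d + 1) * N * (C * (u - w) * N ^ d) + (u - w) * N * (C * N ^ d)
          + d * N * (d * (u - w) * N ^ d) + d * (u - w) * N ^ (d + 1) :=
            le_add_of_nonneg_right (by positivity)
      _ = _ := by ring

lemma pow_sub_le_sub_pow (k : ℕ) {u w : ℝ} (hw : 0 ≤ w) (hwu : w ≤ u) :
    (u - w) ^ (k + 1) ≤ u ^ (k + 1) - w ^ (k + 1) := by
  have := pow_add_pow_le (sub_nonneg.2 hwu) hw (Nat.add_one_ne_zero k)
  rw [sub_add_cancel] at this
  linarith

lemma two_mul_sum_pow_mul_pow_add_le (e : ℕ) {u w : ℝ} (hw : 0 ≤ w) (hwu : w ≤ u) :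
    2 * ∑ i ∈ Finset.range e, u ^ (i + 1) * w ^ (e - i) + e * (u - w) ^ (e + 1)
      ≤ e * (u ^ (e + 1) + w ^ (e + 1)) := by
  have hrefl : ∑ i ∈ Finset.range e, u ^ (i + 1) * w ^ (e - i)
      = ∑ i ∈ Finset.range e, u ^ (e - i) * w ^ (i + 1) := by
    rw [← Finset.sum_range_reflect]
    refine Finset.sum_congr rfl fun i hi => ?_
    rw [Finset.mem_range] at hi
    congr 2 <;> omega
  have hterm : ∀ i ∈ Finset.range e, u ^ (i + 1) * w ^ (e - i) + u ^ (e - i) * w ^ (i + 1)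
      + (u - w) ^ (e + 1) ≤ u ^ (e + 1) + w ^ (e + 1) := fun i hi => by
    rw [Finset.mem_range] at hi
    obtain ⟨k, rfl⟩ : ∃ k, e = i + k + 1 := ⟨e - i - 1, by omega⟩
    have h1 : i + k + 1 - i = k + 1 := by omega
    rw [h1]
    have h0 : 0 ≤ u - w := sub_nonneg.2 hwu
    have := mul_le_mul (pow_sub_le_sub_pow i hw hwu) (pow_sub_le_sub_pow k hw hwu)
      (by positivity) ((by positivity : (0:ℝ) ≤ (u - w) ^ (i + 1)).trans
        (pow_sub_le_sub_pow i hw hwu))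
    ring_nf at this ⊢
    linarith
  have := Finset.sum_le_sum hterm
  simp only [Finset.sum_add_distrib, Finset.sum_const, Finset.card_range, nsmul_eq_mul] at this
  rw [← hrefl] at this
  linarith

lemma mul_pow_sub_mul_pow_le (d : ℕ) {u w : ℝ} (hw : 0 ≤ w) (hwu : w ≤ u) :
    2 * d * (w * u ^ d - u * w ^ d) + d * (d - 1) * (u - w) ^ (d + 1)
      ≤ d * (d - 1) * (u - w) * (u ^ d + w ^ d) := by
  rcases d with _ | e
  · simp
  have h := two_mul_sum_pow_mul_pow_add_le e hw hwu
  have hs : w * u ^ (e + 1) - u * w ^ (e + 1)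
      = (u - w) * ∑ i ∈ Finset.range e, u ^ (i + 1) * w ^ (e - i) := by
    have : ∑ i ∈ Finset.range e, u ^ (i + 1) * w ^ (e - i)
        = u * w * ∑ i ∈ Finset.range e, u ^ i * w ^ (e - 1 - i) := by
      rw [Finset.mul_sum]
      refine Finset.sum_congr rfl fun i hi => ?_
      rw [Finset.mem_range] at hi
      obtain ⟨k, rfl⟩ : ∃ k, e = i + k + 1 := ⟨e - i - 1, by omega⟩
      have h1 : i + k + 1 - i = k + 1 := by omega
      have h2 : i + k + 1 - 1 - i = k := by omega
      rw [h1, h2]; ring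
    rw [this]
    have := geom_sum₂_mul u w e
    linear_combination (-u * w) * this
  have h0 : 0 ≤ u - w := sub_nonneg.2 hwu
  have := mul_le_mul_of_nonneg_left h (by positivity : (0:ℝ) ≤ (e + 1) * (u - w))
  rw [hs]
  push_cast
  ring_nf at this ⊢
  linarith

/-- Up to a positive factor, the gain in the number of copies of `K_{s,s+d}` when a vertex is moved
from a part of size `u + s` to a part of size `w + s - 1`. -/
noncomputable def moveGain (s d : ℕ) (u w : ℝ) : ℝ :=
  fallingFactorial d u * (s * (u - w) - d * (w + s)) +
    fallingFactorial d w * (s * (u - w) + d * (u + s))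

lemma exists_le_moveGain (s d : ℕ) :
    ∃ C : ℝ, 0 ≤ C ∧ ∀ N u w : ℝ, 1 ≤ N → 0 ≤ w → w ≤ u → u ≤ N →
      (u - w) * (N * ((s - d * (d - 1) / 2) * (u ^ d + w ^ d) + d * (d - 1) / 2 * (u - w) ^ d)
        - C * N ^ d) ≤ N * moveGain s d u w := by
  obtain ⟨C, hC, h⟩ := exists_fallingFactorial_sub_pow_bound d
  refine ⟨2 * s * C + 2 * d * C + d * s * d + d * s * C, by positivity,
    fun N u w hN hw hwu hu => ?_⟩
  obtain ⟨h1, h2, h3⟩ := h N u w hN hw hwu hu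
  have h4 := pow_sub_pow_mul_le d hw hwu hu
  have h5 := mul_pow_sub_mul_pow_le d hw hwu
  have h0 : 0 ≤ u - w := sub_nonneg.2 hwu
  have hN0 : 0 < N := by linarith
  rw [moveGain]
  obtain ⟨a, ha⟩ : ∃ a, a = fallingFactorial d u - u ^ d := ⟨_, rfl⟩
  obtain ⟨b, hb⟩ : ∃ b, b = fallingFactorial d w - w ^ d := ⟨_, rfl⟩
  rw [← ha] at h1 h3
  rw [← hb] at h2 h3
  rw [show fallingFactorial d u = u ^ d + a by linarith,
    show fallingFactorial d w = w ^ d + b by linarith]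
  have g1 : -(C * N ^ d) ≤ a * N := by
    have := mul_le_mul_of_nonneg_right (neg_abs_le a) hN0.le
    linarith
  have g2 : -(C * N ^ d) ≤ b * N := by
    have := mul_le_mul_of_nonneg_right (neg_abs_le b) hN0.le
    linarith
  have g3 : (a - b) * N * N ≤ C * (u - w) * N ^ d := by
    have := mul_le_mul_of_nonneg_right (le_abs_self (a - b)) (sq_nonneg N)
    linarith
  have g3' : (a - b) * N * w ≤ C * (u - w) * N ^ d := by
    rcases le_total 0 (a - b) with h | h
    · exact (mul_le_mul_of_nonneg_left (hwu.trans hu) (by positivity)).trans g3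
    · have : (a - b) * (N * w) ≤ 0 := mul_nonpos_of_nonpos_of_nonneg h (by positivity)
      have : 0 ≤ C * (u - w) * N ^ d := by positivity
      linarith
  have g3'' : (a - b) * N ≤ C * (u - w) * N ^ d := by
    rcases le_total 0 (a - b) with h | h
    · exact (le_mul_of_one_le_right (by positivity) hN).trans g3
    · have : (a - b) * N ≤ 0 := mul_nonpos_of_nonpos_of_nonneg h (by positivity)
      have : 0 ≤ C * (u - w) * N ^ d := by positivity
      linarith
  have k1 := mul_le_mul_of_nonneg_left g1 (by positivity : (0:ℝ) ≤ s * (u - w))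
  have k2 := mul_le_mul_of_nonneg_left g2 (by positivity : (0:ℝ) ≤ s * (u - w))
  have k2' := mul_le_mul_of_nonneg_left g2 (by positivity : (0:ℝ) ≤ d * (u - w))
  have k3 := mul_le_mul_of_nonneg_left g3' (by positivity : (0:ℝ) ≤ d)
  have k3' := mul_le_mul_of_nonneg_left g3'' (by positivity : (0:ℝ) ≤ d * s)
  have k4 := mul_le_mul_of_nonneg_left h4 (by positivity : (0:ℝ) ≤ d * s)
  have k5 := mul_le_mul_of_nonneg_left h5 (by positivity : (0:ℝ) ≤ N / 2)
  ring_nf at k1 k2 k2' k3 k3' k4 k5 ⊢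
  linarith

lemma moveGain_pos_of_linear_gap (s d : ℕ) (hs : 1 ≤ s) (hd : (d : ℝ) * (d - 1) ≤ 2 * s) {δ : ℝ}
    (hδ : 0 < δ) : ∃ N₀ : ℝ, ∀ N u w : ℝ, N₀ ≤ N → 0 ≤ w → w ≤ u → u ≤ N → δ * N ≤ u - w →
      0 < moveGain s d u w := by
  obtain ⟨C, hC, h⟩ := exists_le_moveGain s d
  refine ⟨C / δ ^ d + 1, fun N u w hN hw hwu hu hgap => ?_⟩
  have hNC : C < N * δ ^ d := by
    rw [← div_lt_iff₀ (by positivity)]; linarith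
  have hN1 : 1 ≤ N := by
    have : 0 ≤ C / δ ^ d := by positivity
    linarith
  have hN0 : 0 < N := by linarith
  have hu0 : 0 < u - w := lt_of_lt_of_le (by positivity) hgap
  have h1 := h N u w hN1 hw hwu hu
  have h2 : (δ * N) ^ d ≤ (u - w) ^ d := pow_le_pow_left₀ (by positivity) hgap d
  have h3 : (u - w) ^ d ≤ u ^ d := pow_le_pow_left₀ hu0.le (by linarith) d
  have h4 : 0 ≤ w ^ d := by positivity
  have hs' : (1 : ℝ) ≤ s := by exact_mod_cast hs
  have h5 : (δ * N) ^ d ≤ (s - d * (d - 1) / 2) * (u ^ d + w ^ d)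
      + d * (d - 1) / 2 * (u - w) ^ d := by
    have : (s - d * (d - 1) / 2) * (u - w) ^ d ≤ (s - d * (d - 1) / 2) * (u ^ d + w ^ d) :=
      mul_le_mul_of_nonneg_left (by linarith) (by linarith)
    have : 1 * (u - w) ^ d ≤ s * (u - w) ^ d := by gcongr
    linarith
  have h6 : 0 < (N * δ ^ d - C) * N ^ d := mul_pos (by linarith) (by positivity)
  have h7 := mul_le_mul_of_nonneg_left h5 hN0.le
  rw [mul_pow] at h7
  refine pos_of_mul_pos_right (lt_of_lt_of_le (mul_pos hu0 ?_) h1) hN0.le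
  linarith

lemma moveGain_pos_of_linear_max (s d : ℕ) (hd : (d : ℝ) * (d - 1) < 2 * s) {δ : ℝ}
    (hδ : 0 < δ) : ∃ N₀ : ℝ, ∀ N u w : ℝ, N₀ ≤ N → 0 ≤ w → w < u → u ≤ N → δ * N ≤ u →
      0 < moveGain s d u w := by
  obtain ⟨C, hC, h⟩ := exists_le_moveGain s d
  obtain ⟨η, hη⟩ : ∃ η : ℝ, η = s - d * (d - 1) / 2 := ⟨_, rfl⟩
  have hη0 : 0 < η := by linarith
  refine ⟨C / (η * δ ^ d) + 1, fun N u w hN hw hwu hu hgap => ?_⟩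
  have hNC : C < N * (η * δ ^ d) := by
    rw [← div_lt_iff₀ (by positivity)]; linarith
  have hN1 : 1 ≤ N := by
    have : 0 ≤ C / (η * δ ^ d) := by positivity
    linarith
  have hN0 : 0 < N := by linarith
  have hu0 : 0 < u - w := sub_pos.2 hwu
  have h1 := h N u w hN1 hw hwu.le hu
  rw [← hη] at h1
  have h2 : (δ * N) ^ d ≤ u ^ d := pow_le_pow_left₀ (by positivity) hgap d
  have h4 : 0 ≤ w ^ d := by positivity
  have h5 : η * (δ * N) ^ d ≤ η * (u ^ d + w ^ d) + d * (d - 1) / 2 * (u - w) ^ d := by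
    have : η * (δ * N) ^ d ≤ η * (u ^ d + w ^ d) :=
      mul_le_mul_of_nonneg_left (by linarith) hη0.le
    have h8 : (0 : ℝ) ≤ d * (d - 1) := by
      rcases d with _ | d
      · simp
      · push_cast; rw [add_sub_cancel_right]; positivity
    have : 0 ≤ d * (d - 1) / 2 * (u - w) ^ d := by positivity
    linarith
  have h6 : 0 < (N * (η * δ ^ d) - C) * N ^ d := mul_pos (by linarith) (by positivity)
  have h7 := mul_le_mul_of_nonneg_left h5 hN0.le
  rw [mul_pow] at h7
  refine pos_of_mul_pos_right (lt_of_lt_of_le (mul_pos hu0 ?_) h1) hN0.le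
  linarith

/-- The number of ways to choose one of the parts of sizes `m`, `t` vertices in it, and `s` vertices
in each of the other parts. -/
def placements {r : ℕ} (s t : ℕ) (m : Fin r → ℕ) : ℕ :=
  ∑ i, ∏ j, (m j).choose (if j = i then t else s)

lemma placements_mul_factorial {r : ℕ} (s d : ℕ) (m : Fin r → ℕ) (hm : ∀ j, s ≤ m j) :
    (placements s (s + d) m : ℝ) * ((s + d).factorial : ℝ) =
      s.factorial * ((∏ j, ((m j).choose s : ℝ)) * ∑ i, fallingFactorial d ((m i : ℝ) - s)) := by
  have hterm : ∀ i, (∏ j, (m j).choose (if j = i then s + d else s)) * (s + d).factorial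
      = s.factorial * ((∏ j, (m j).choose s) * (m i - s).descFactorial d) := fun i => by
    rw [← Finset.mul_prod_erase _ _ (Finset.mem_univ i),
      ← Finset.mul_prod_erase Finset.univ (fun j => (m j).choose s) (Finset.mem_univ i),
      Finset.prod_congr rfl (fun j hj => by rw [if_neg (Finset.ne_of_mem_erase hj)]), if_pos rfl]
    have h1 := Nat.descFactorial_eq_factorial_mul_choose (m i) (s + d)
    have h2 := Nat.descFactorial_eq_factorial_mul_choose (m i) s
    have h3 := Nat.descFactorial_mul_descFactorial (n := m i) (Nat.le_add_right s d)
    rw [Nat.add_sub_cancel_left] at h3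
    have h4 : (m i).choose (s + d) * (s + d).factorial
        = s.factorial * ((m i).choose s * (m i - s).descFactorial d) := by
      rw [mul_comm, ← h1, ← h3, h2]; ring
    rw [mul_right_comm, h4]; ring
  have : placements s (s + d) m * (s + d).factorial
      = s.factorial * ((∏ j, (m j).choose s) * ∑ i, (m i - s).descFactorial d) := by
    rw [placements, Finset.sum_mul, Finset.mul_sum, Finset.mul_sum]
    exact Finset.sum_congr rfl fun i _ => hterm i
  have hcast : ∀ i, fallingFactorial d ((m i : ℝ) - s) = ((m i - s).descFactorial d : ℕ) :=
    fun i => by rw [← fallingFactorial_natCast, Nat.cast_sub (hm i)]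
  simp_rw [hcast]
  exact_mod_cast this

lemma placements_lt_of_move {r : ℕ} (s d : ℕ) {m m' : Fin r → ℕ} (hm : ∀ j, s ≤ m j)
    {i j : Fin r} (hij : m j + 2 ≤ m i) (hi : m' i + 1 = m i) (hj : m' j = m j + 1)
    (hk : ∀ k, k ≠ i → k ≠ j → m' k = m k)
    (hgain : 0 < moveGain s d ((m i : ℝ) - s) ((m j : ℝ) - s + 1)) :
    placements s (s + d) m < placements s (s + d) m' := by
  have hne : j ≠ i := by rintro rfl; omega
  have hmj := hm j
  have hm' : ∀ k, s ≤ m' k := fun k => by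
    by_cases h1 : k = i
    · subst h1; omega
    by_cases h2 : k = j
    · subst h2; omega
    rw [hk k h1 h2]; exact hm k
  have hmem : j ∈ Finset.univ.erase i := by simp [hne]
  have hsplit : ∀ f : Fin r → ℝ,
      ∏ k, f k = f i * (f j * ∏ k ∈ (Finset.univ.erase i).erase j, f k) := fun f => by
    rw [Finset.mul_prod_erase _ _ hmem, Finset.mul_prod_erase _ _ (Finset.mem_univ i)]
  have hsplit' : ∀ f : Fin r → ℝ,
      ∑ k, f k = f i + (f j + ∑ k ∈ (Finset.univ.erase i).erase j, f k) := fun f => by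
    rw [Finset.add_sum_erase _ _ hmem, Finset.add_sum_erase _ _ (Finset.mem_univ i)]
  have hcongr : ∀ k ∈ (Finset.univ.erase i).erase j, m' k = m k := fun k hk' => by
    simp only [Finset.mem_erase, Finset.mem_univ, and_true] at hk'
    exact hk k hk'.2 hk'.1
  have hfac : (0 : ℝ) < (s + d).factorial := by positivity
  have hfac' : (0 : ℝ) < s.factorial := by positivity
  suffices h : (placements s (s + d) m : ℝ) * ((s + d).factorial : ℝ)
      < (placements s (s + d) m' : ℝ) * ((s + d).factorial : ℝ) by
    exact_mod_cast lt_of_mul_lt_mul_right h hfac.le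
  rw [placements_mul_factorial s d m hm, placements_mul_factorial s d m' hm']
  refine mul_lt_mul_of_pos_left ?_ hfac'
  have hprod : ∏ k ∈ (Finset.univ.erase i).erase j, ((m' k).choose s : ℝ)
      = ∏ k ∈ (Finset.univ.erase i).erase j, ((m k).choose s : ℝ) :=
    Finset.prod_congr rfl fun k hk' => by rw [hcongr k hk']
  have hsum : ∑ k ∈ (Finset.univ.erase i).erase j, fallingFactorial d ((m' k : ℝ) - s)
      = ∑ k ∈ (Finset.univ.erase i).erase j, fallingFactorial d ((m k : ℝ) - s) :=
    Finset.sum_congr rfl fun k hk' => by rw [hcongr k hk']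
  rw [hsplit, hsplit, hsplit', hsplit', hprod, hsum]
  set A := ∑ k ∈ (Finset.univ.erase i).erase j, fallingFactorial d ((m k : ℝ) - s) with hA
  set P := ∏ k ∈ (Finset.univ.erase i).erase j, ((m k).choose s : ℝ) with hP
  have hA0 : 0 ≤ A := Finset.sum_nonneg fun k _ => by
    rw [← Nat.cast_sub (hm k), fallingFactorial_natCast]; positivity
  have hP0 : 0 < P := Finset.prod_pos fun k _ => by
    exact_mod_cast Nat.choose_pos (hm k)
  have hci : (0 : ℝ) < (m i).choose s := by exact_mod_cast Nat.choose_pos (hm i)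
  have hcj : (0 : ℝ) < (m j).choose s := by exact_mod_cast Nat.choose_pos (hm j)
  obtain ⟨v, hv⟩ : ∃ v, m j = v + s := ⟨m j - s, by omega⟩
  obtain ⟨u, hu⟩ : ∃ u, m i = u + 1 + s := ⟨m i - s - 1, by omega⟩
  have hm'i : m' i = u + s := by omega
  have hm'j : m' j = v + s + 1 := by omega
  have e1 : ((m' i).choose s : ℝ) * (u + 1 + s) = (m i).choose s * (u + 1) := by
    have := Nat.choose_mul_succ_eq (u + s) s
    rw [show u + s + 1 - s = u + 1 by omega, show u + s + 1 = u + 1 + s by omega] at this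
    rw [hm'i, hu]
    exact_mod_cast this
  have e2 : ((m' j).choose s : ℝ) * (v + 1) = (m j).choose s * (v + 1 + s) := by
    have := Nat.choose_mul_succ_eq (v + s) s
    rw [show v + s + 1 - s = v + 1 by omega] at this
    rw [hm'j, hv]
    have : ((v + s).choose s : ℝ) * (v + s + 1) = ((v + s + 1).choose s) * (v + 1) := by
      exact_mod_cast this
    linarith
  have f1 := mul_fallingFactorial_sub_one d ((u : ℝ) + 1)
  have f2 := mul_fallingFactorial_sub_one d ((v : ℝ) + 1)
  rw [add_sub_cancel_right] at f1 f2
  have c1 : (m i : ℝ) - s = u + 1 := by rw [hu]; push_cast; ring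
  have c2 : (m j : ℝ) - s = v := by rw [hv]; push_cast; ring
  have c3 : (m' i : ℝ) - s = u := by rw [hm'i]; push_cast; ring
  have c4 : (m' j : ℝ) - s = v + 1 := by rw [hm'j]; push_cast; ring
  rw [c1, c2, moveGain] at hgain
  rw [c1, c2, c3, c4]
  have huv : (v : ℝ) + 1 ≤ u := by
    have : v + 1 ≤ u := by omega
    exact_mod_cast this
  have hM : (0 : ℝ) < (u + 1 + s) * (v + 1) := by positivity
  refine lt_of_mul_lt_mul_right ?_ hM.le
  have hx : (0 : ℝ) < (m i).choose s * (m j).choose s * P := by positivity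
  have hy := mul_pos hx (add_pos_of_pos_of_nonneg hgain
    (by have : (0 : ℝ) ≤ u + 1 - (v + 1) := by linarith
        positivity : (0 : ℝ) ≤ s * (u + 1 - (v + 1)) * A))
  have l1 : ((m' i).choose s : ℝ) * ((m' j).choose s * P) *
      (fallingFactorial d u + (fallingFactorial d (v + 1) + A)) * ((u + 1 + s) * (v + 1))
      = (m i).choose s * (m j).choose s * P * ((u + 1) * (v + 1 + s) *
        (fallingFactorial d u + (fallingFactorial d (v + 1) + A))) := by
    linear_combination (P * (fallingFactorial d u + (fallingFactorial d (v + 1) + A))) *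
      ((m' j).choose s * (v + 1) * e1 + (m i).choose s * (u + 1) * e2)
  rw [l1]
  have l2 : (u + 1 : ℝ) * (v + 1 + s) * (fallingFactorial d u + (fallingFactorial d (v + 1) + A))
      - (u + 1 + s) * (v + 1) * (fallingFactorial d (u + 1) + (fallingFactorial d v + A))
      = fallingFactorial d (u + 1) * (s * (u + 1 - (v + 1)) - d * (v + 1 + s)) +
        fallingFactorial d (v + 1) * (s * (u + 1 - (v + 1)) + d * (u + 1 + s))
        + s * (u + 1 - (v + 1)) * A := by
    linear_combination (v + 1 + s : ℝ) * f1 - (u + 1 + s) * f2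
  rw [← l2] at hy
  linarith

open Classical in
/-- The number of vertices of colour `j`. -/
noncomputable def classSize {V : Type*} [Fintype V] {r : ℕ} (f : V → Fin r) (j : Fin r) : ℕ :=
  (Finset.univ.filter fun v => f v = j).card

open Classical in
/-- `S` has `t` vertices of one colour and `s` vertices of each of the other colours. -/
def IsPlacement {V : Type*} {r : ℕ} (s t : ℕ) (f : V → Fin r) (S : Finset V) : Prop :=
  ∃ i, ∀ j, (S.filter fun v => f v = j).card = if j = i then t else s

lemma Kmulti_adj {r s t : ℕ} (x y : Σ i : Fin r, Fin (if (i : ℕ) = 0 then t else s)) :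
    (Kmulti r s t).Adj x y ↔ x.1 ≠ y.1 := Iff.rfl

open Classical in
/-- The colour classes of a copy of `K_{s,t}` in an `r`-coloured graph are the parts of the copy. -/
lemma isPlacement_verts_of_iso {V : Type*} [Fintype V] {r s t : ℕ} (hr : 0 < r) (hs : 1 ≤ s)
    (ht : 1 ≤ t) {G : SimpleGraph V} {f : V → Fin r} (hf : ∀ v w, G.Adj v w → f v ≠ f w)
    (H : G.Subgraph) (φ : H.coe ≃g Kmulti r s t) :
    IsPlacement s t f H.verts.toFinset ∧
      ∀ v w, H.Adj v w ↔ v ∈ H.verts ∧ w ∈ H.verts ∧ f v ≠ f w := by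
  have hadj : ∀ v w : H.verts, H.Adj v w ↔ (φ v).1 ≠ (φ w).1 := fun v w => by
    rw [← Kmulti_adj, φ.map_adj_iff, Subgraph.coe_adj]
  have hpos : ∀ k : Fin r, 0 < (if (k : ℕ) = 0 then t else s) := fun k => by
    split_ifs <;> omega
  let x : Fin r → H.verts := fun k => φ.symm ⟨k, ⟨0, hpos k⟩⟩
  have hx : ∀ k, (φ (x k)).1 = k := fun k => by simp [x]
  have hcol : ∀ v w : H.verts, f v = f w → (φ v).1 = (φ w).1 := fun v w h => by
    by_contra hne
    exact hf _ _ (((hadj v w).2 hne).adj_sub) h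
  let g : Fin r → Fin r := fun k => f (x k)
  have hg : Function.Bijective g := Finite.injective_iff_bijective.1 fun k l h => by
    rw [← hx k, ← hx l]; exact hcol _ _ h
  have hfg : ∀ v : H.verts, f v = g (φ v).1 := fun v => by
    obtain ⟨k, hk⟩ := hg.2 (f v)
    have h1 : (φ v).1 = k := by rw [← hx k]; exact hcol _ _ hk.symm
    rw [h1, hk]
  refine ⟨⟨g ⟨0, hr⟩, fun j => ?_⟩, fun v w => ⟨fun h => ?_, fun ⟨hv, hw, h⟩ => ?_⟩⟩
  · obtain ⟨k, rfl⟩ := hg.2 j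
    have e1 : {v // v ∈ H.verts.toFinset.filter fun v => f v = g k}
        ≃ {v : H.verts // (φ v).1 = k} :=
      { toFun := fun v => ⟨⟨v.1, Set.mem_toFinset.1 (Finset.mem_filter.1 v.2).1⟩, by
          have := v.2
          simp only [Finset.mem_filter, Set.mem_toFinset] at this
          have h2 := hfg ⟨v.1, this.1⟩
          exact hg.1 (h2.symm.trans this.2)⟩
        invFun := fun v => ⟨v.1.1, by
          simp only [Finset.mem_filter, Set.mem_toFinset]
          exact ⟨v.1.2, by rw [hfg v.1, v.2]⟩⟩
        left_inv := fun v => rfl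
        right_inv := fun v => rfl }
    have e2 : {v : H.verts // (φ v).1 = k} ≃
        {y : Σ i : Fin r, Fin (if (i : ℕ) = 0 then t else s) // y.1 = k} :=
      φ.toEquiv.subtypeEquiv fun v => Iff.rfl
    have := Nat.card_congr ((e1.trans e2).trans (Equiv.sigmaSubtype k))
    rw [Nat.card_eq_fintype_card, Fintype.card_coe, Nat.card_eq_fintype_card,
      Fintype.card_fin] at this
    rw [this]
    have h3 : g k = g ⟨0, hr⟩ ↔ (k : ℕ) = 0 := by
      rw [hg.1.eq_iff, Fin.ext_iff]
    simp only [h3]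
  · exact ⟨H.edge_vert h, H.edge_vert h.symm, hf _ _ h.adj_sub⟩
  · refine (hadj ⟨v, hv⟩ ⟨w, hw⟩).2 fun h2 => h ?_
    have h3 := hfg ⟨v, hv⟩
    have h4 := hfg ⟨w, hw⟩
    exact h3.trans ((congrArg g h2).trans h4.symm)

open Classical in
lemma exists_subgraph_of_isPlacement {V : Type*} [Fintype V] {r s t : ℕ} (hr : 0 < r)
    {G : SimpleGraph V} {f : V → Fin r} {S : Finset V} (hS : IsPlacement s t f S)
    (hG : ∀ v ∈ S, ∀ w ∈ S, f v ≠ f w → G.Adj v w) :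
    ∃ H : G.Subgraph, H.verts.toFinset = S ∧ Nonempty (H.coe ≃g Kmulti r s t) := by
  obtain ⟨i, hi⟩ := hS
  let σ : Equiv.Perm (Fin r) := Equiv.swap i ⟨0, hr⟩
  let H : G.Subgraph :=
    { verts := S
      Adj := fun v w => v ∈ S ∧ w ∈ S ∧ f v ≠ f w
      adj_sub := fun h => hG _ h.1 _ h.2.1 h.2.2
      edge_vert := fun h => h.1
      symm := ⟨fun v w h => ⟨h.2.1, h.1, h.2.2.symm⟩⟩ }
  have hcard : ∀ k : Fin r,
      Fintype.card {v : H.verts // σ (f v) = k} = if (k : ℕ) = 0 then t else s := fun k => by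
    have e : {v : H.verts // σ (f v) = k} ≃ {v // v ∈ S.filter fun v => f v = σ k} :=
      { toFun := fun v => ⟨v.1.1, by
          have h1 : v.1.1 ∈ S := v.1.2
          rw [Finset.mem_filter]
          exact ⟨h1, by rw [← σ.injective.eq_iff, v.2]; simp [σ]⟩⟩
        invFun := fun v => ⟨⟨v.1, (Finset.mem_filter.1 v.2).1⟩, by
          have := (Finset.mem_filter.1 v.2).2
          simp only [this]
          simp [σ]⟩
        left_inv := fun v => rfl
        right_inv := fun v => rfl }
    rw [Fintype.card_congr e, Fintype.card_coe, hi]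
    have h3 : σ k = i ↔ (k : ℕ) = 0 := by
      have : i = σ ⟨0, hr⟩ := by simp [σ]
      conv_lhs => rw [this]
      rw [σ.injective.eq_iff, Fin.ext_iff]
    simp only [h3]
  let e : H.verts ≃ Σ k : Fin r, Fin (if (k : ℕ) = 0 then t else s) :=
    (Equiv.sigmaFiberEquiv fun v : H.verts => σ (f v)).symm.trans
      (Equiv.sigmaCongrRight fun k => Fintype.equivFinOfCardEq (hcard k))
  refine ⟨H, by simp [H], ⟨⟨e, fun {v w} => ?_⟩⟩⟩
  have hv : v.1 ∈ S := v.2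
  have hw : w.1 ∈ S := w.2
  have he : ∀ v, (e v).1 = σ (f v) := fun v => rfl
  rw [Kmulti_adj, he, he, σ.injective.ne_iff, Subgraph.coe_adj]
  exact ⟨fun h => ⟨hv, hw, h⟩, fun h => h.2.2⟩

lemma copies_Kmulti_eq {V : Type*} [Fintype V] {r s t : ℕ} (hr : 0 < r) (hs : 1 ≤ s) (ht : 1 ≤ t)
    {G : SimpleGraph V} {f : V → Fin r} (hf : ∀ v w, G.Adj v w → f v ≠ f w) :
    copies (Kmulti r s t) G = Nat.card {S : Finset V //
      IsPlacement s t f S ∧ ∀ v ∈ S, ∀ w ∈ S, f v ≠ f w → G.Adj v w} := by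
  classical
  refine Nat.card_eq_of_bijective
    (fun H => ⟨H.1.verts.toFinset, ?_, fun v hv w hw h => ?_⟩) ⟨fun H₁ H₂ h => ?_, fun S => ?_⟩
  · obtain ⟨φ⟩ := H.2
    exact (isPlacement_verts_of_iso hr hs ht hf H.1 φ).1
  · obtain ⟨φ⟩ := H.2
    rw [Set.mem_toFinset] at hv hw
    exact (((isPlacement_verts_of_iso hr hs ht hf H.1 φ).2 v w).2 ⟨hv, hw, h⟩).adj_sub
  · have hverts : H₁.1.verts = H₂.1.verts := Set.toFinset_inj.1 (congrArg Subtype.val h)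
    obtain ⟨φ₁⟩ := H₁.2
    obtain ⟨φ₂⟩ := H₂.2
    refine Subtype.ext (Subgraph.ext hverts ?_)
    funext v w
    rw [(isPlacement_verts_of_iso hr hs ht hf H₁.1 φ₁).2 v w,
      (isPlacement_verts_of_iso hr hs ht hf H₂.1 φ₂).2 v w, hverts]
  · obtain ⟨H, h1, h2⟩ := exists_subgraph_of_isPlacement hr S.2.1 S.2.2
    exact ⟨⟨H, h2⟩, Subtype.ext h1⟩

open Classical in
lemma card_filter_forall_card_eq {V : Type*} [Fintype V] {r : ℕ} (f : V → Fin r)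
    (k : Fin r → ℕ) :
    (Finset.univ.filter fun S : Finset V => ∀ j, (S.filter fun v => f v = j).card = k j).card
      = ∏ j, (classSize f j).choose (k j) := by
  have : ∏ j, (classSize f j).choose (k j) = (Fintype.piFinset fun j =>
      Finset.powersetCard (k j) (Finset.univ.filter fun v => f v = j)).card := by
    rw [Fintype.card_piFinset]
    exact Finset.prod_congr rfl fun j _ => by rw [Finset.card_powersetCard, classSize]
  rw [this]
  have hfilter : ∀ g ∈ Fintype.piFinset fun j =>
      Finset.powersetCard (k j) (Finset.univ.filter fun v => f v = j),
      ∀ j, ((Finset.univ.biUnion g).filter fun v => f v = j) = g j := fun g hg j => by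
    simp only [Fintype.mem_piFinset, Finset.mem_powersetCard] at hg
    ext v
    simp only [Finset.mem_filter, Finset.mem_biUnion, Finset.mem_univ, true_and]
    constructor
    · rintro ⟨⟨l, hl⟩, hv⟩
      have := (hg l).1 hl
      simp only [Finset.mem_filter, Finset.mem_univ, true_and] at this
      rwa [← hv, this]
    · intro hv
      have := (hg j).1 hv
      simp only [Finset.mem_filter, Finset.mem_univ, true_and] at this
      exact ⟨⟨j, hv⟩, this⟩
  refine Finset.card_bij' (fun S _ j => S.filter fun v => f v = j)
    (fun g _ => Finset.univ.biUnion g) ?_ ?_ ?_ ?_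
  · intro S hS
    simp only [Finset.mem_filter, Finset.mem_univ, true_and] at hS
    simp only [Fintype.mem_piFinset, Finset.mem_powersetCard]
    exact fun j => ⟨Finset.filter_subset_filter _ (Finset.subset_univ S), hS j⟩
  · intro g hg
    simp only [Finset.mem_filter, Finset.mem_univ, true_and]
    intro j
    rw [hfilter g hg j]
    simp only [Fintype.mem_piFinset, Finset.mem_powersetCard] at hg
    exact (hg j).2
  · intro S _
    ext v
    simp
  · intro g hg
    funext j
    exact hfilter g hg j

/-- When `s = t`, each copy is counted once for each part. -/
lemma card_isPlacement_mul {V : Type*} [Fintype V] {r : ℕ} (hr : 0 < r) (s t : ℕ)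
    (f : V → Fin r) :
    Nat.card {S : Finset V // IsPlacement s t f S} * (if s = t then r else 1)
      = placements s t (classSize f) := by
  classical
  rw [Nat.card_eq_fintype_card, Fintype.card_subtype, placements]
  simp_rw [← card_filter_forall_card_eq]
  split_ifs with h
  · subst h
    have : ∀ S : Finset V, IsPlacement s s f S ↔
        ∀ j, (S.filter fun v => f v = j).card = s := fun S => by
      simp only [IsPlacement, ite_self]
      exact ⟨fun ⟨_, h⟩ => h, fun h => ⟨⟨0, hr⟩, h⟩⟩
    simp only [this, ite_self, Finset.sum_const, Finset.card_univ, Fintype.card_fin, smul_eq_mul]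
    rw [mul_comm]
  · rw [mul_one, ← Finset.card_biUnion]
    · congr 1
      ext S
      simp only [Finset.mem_filter, Finset.mem_biUnion, Finset.mem_univ, true_and]
      rfl
    · intro i _ i' _ hne
      refine Finset.disjoint_left.2 fun S h1 h2 => ?_
      simp only [Finset.mem_filter, Finset.mem_univ, true_and] at h1 h2
      have h3 := h1 i
      rw [h2 i, if_neg hne, if_pos rfl] at h3
      exact h h3

open Classical in
lemma exists_isPlacement_superset {V : Type*} [Fintype V] {r s t : ℕ} (hs : 1 ≤ s) (ht : 1 ≤ t)
    (f : V → Fin r) (hsize : ∀ j, s ≤ classSize f j) {i : Fin r} (hi : t ≤ classSize f i)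
    (T : Finset V) (hT : ∀ j, (T.filter fun v => f v = j).card ≤ 1) :
    ∃ S, T ⊆ S ∧ IsPlacement s t f S := by
  have h : ∀ j, ∃ A : Finset V, (T.filter fun v => f v = j) ⊆ A ∧
      A ⊆ (Finset.univ.filter fun v => f v = j) ∧ A.card = if j = i then t else s := fun j => by
    refine Finset.exists_subsuperset_card_eq
      (Finset.filter_subset_filter _ (Finset.subset_univ T)) ((hT j).trans ?_) ?_
    · split_ifs <;> assumption
    · have := hsize j
      split_ifs with hj
      · subst hj; exact hi
      · exact this
  choose A hA1 hA2 hA3 using h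
  refine ⟨Finset.univ.biUnion A, fun v hv => ?_, i, fun j => ?_⟩
  · exact Finset.mem_biUnion.2 ⟨f v, Finset.mem_univ _, hA1 _ (by simp [hv])⟩
  · rw [← hA3 j]
    congr 1
    ext v
    have hcol : ∀ l, v ∈ A l → f v = l := fun l hl => by simpa using hA2 l hl
    simp only [Finset.mem_filter, Finset.mem_biUnion, Finset.mem_univ, true_and]
    constructor
    · rintro ⟨⟨l, hl⟩, rfl⟩
      rwa [hcol l hl]
    · exact fun hv => ⟨⟨j, hv⟩, hcol j hv⟩

lemma IsPlacement.le_classSize {V : Type*} [Fintype V] {r s t : ℕ} (hst : s ≤ t) {f : V → Fin r}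
    {S : Finset V} (hS : IsPlacement s t f S) :
    (∀ j, s ≤ classSize f j) ∧ ∃ i, t ≤ classSize f i := by
  classical
  obtain ⟨i, hi⟩ := hS
  have h : ∀ j, (if j = i then t else s) ≤ classSize f j := fun j => by
    rw [← hi j]
    exact Finset.card_le_card (Finset.filter_subset_filter _ (Finset.subset_univ S))
  refine ⟨fun j => le_trans ?_ (h j), i, by simpa using h i⟩
  split_ifs <;> omega

lemma exists_coloring_le_classSize {r t n : ℕ} (hr : 0 < r) (hn : r * t ≤ n) :
    ∃ f : Fin n → Fin r, ∀ j, t ≤ classSize f j := by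
  classical
  refine ⟨fun v => ⟨v % r, Nat.mod_lt _ hr⟩, fun j => ?_⟩
  have hlt : ∀ x : Fin t, x * r + j < n := fun x => by
    have h1 : (x + 1) * r ≤ t * r := Nat.mul_le_mul_right r x.2
    have h2 := j.2
    nlinarith
  have := Finset.card_le_card_of_injOn (s := (Finset.univ : Finset (Fin t)))
    (t := Finset.univ.filter fun v : Fin n => (⟨v % r, Nat.mod_lt _ hr⟩ : Fin r) = j)
    (fun x => ⟨x * r + j, hlt x⟩) (fun x _ => by
      simp [Fin.ext_iff, Nat.mod_eq_of_lt j.2])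
    (fun x _ y _ hxy => by
      simp only [Fin.mk.injEq, Nat.add_right_cancel_iff] at hxy
      exact Fin.ext (Nat.eq_of_mul_eq_mul_right hr hxy))
  simpa [classSize] using this

lemma sum_classSize {V : Type*} [Fintype V] {r : ℕ} (f : V → Fin r) :
    ∑ j, classSize f j = Fintype.card V := by
  classical
  exact (Finset.card_eq_sum_card_fiberwise (fun v _ => Finset.mem_univ (f v))).symm

/-- The complete multipartite graph on the colour classes of `f`. -/
def multipartiteOf {V : Type*} {r : ℕ} (f : V → Fin r) : SimpleGraph V :=
  SimpleGraph.comap f ⊤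

lemma multipartiteOf_adj {V : Type*} {r : ℕ} (f : V → Fin r) (v w : V) :
    (multipartiteOf f).Adj v w ↔ f v ≠ f w := by
  simp [multipartiteOf]

lemma copies_multipartiteOf {V : Type*} [Fintype V] {r s t : ℕ} (hr : 0 < r) (hs : 1 ≤ s)
    (ht : 1 ≤ t) (f : V → Fin r) :
    copies (Kmulti r s t) (multipartiteOf f) = Nat.card {S : Finset V // IsPlacement s t f S} := by
  rw [copies_Kmulti_eq hr hs ht fun v w h => (multipartiteOf_adj f v w).1 h]
  refine Nat.card_congr (Equiv.subtypeEquivRight fun S => ?_)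
  simp only [multipartiteOf_adj]
  tauto

/-- A maximizer is complete multipartite, and no move of a vertex from a larger part to a smaller
one has a positive gain. -/
lemma exists_coloring_of_maximizer {r s d n : ℕ} (hr : 0 < r) (hs : 1 ≤ s)
    (hn : r * (s + d) ≤ n) {G : SimpleGraph (Fin n)} (hG : IsMultipartite r G)
    (hmax : ∀ G' : SimpleGraph (Fin n), IsMultipartite r G' →
      copies (Kmulti r s (s + d)) G' ≤ copies (Kmulti r s (s + d)) G) :
    ∃ f : Fin n → Fin r, (∀ v w, G.Adj v w ↔ f v ≠ f w) ∧ (∀ j, s ≤ classSize f j) ∧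
      ∀ i j, classSize f j + 2 ≤ classSize f i →
        moveGain s d ((classSize f i : ℝ) - s) ((classSize f j : ℝ) - s + 1) ≤ 0 := by
  classical
  have ht : 1 ≤ s + d := by omega
  have hmax' : ∀ f' : Fin n → Fin r, Nat.card {S // IsPlacement s (s + d) f' S}
      ≤ copies (Kmulti r s (s + d)) G := fun f' => by
    rw [← copies_multipartiteOf hr hs ht]
    exact hmax _ ⟨f', fun v w h => (multipartiteOf_adj f' v w).1 h⟩
  obtain ⟨f, hf⟩ := hG
  have hpos : 0 < copies (Kmulti r s (s + d)) G := by
    obtain ⟨f₀, hf₀⟩ := exists_coloring_le_classSize hr hn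
    obtain ⟨S, -, hS⟩ := exists_isPlacement_superset hs ht f₀
      (fun j => (Nat.le_add_right s d).trans (hf₀ j)) (hf₀ ⟨0, hr⟩) ∅ (by simp)
    refine lt_of_lt_of_le ?_ (hmax' f₀)
    have : Nonempty {S // IsPlacement s (s + d) f₀ S} := ⟨⟨S, hS⟩⟩
    exact Nat.card_pos
  have hcopies := copies_Kmulti_eq hr hs ht hf
  obtain ⟨hsize, i₀, hi₀⟩ : (∀ j, s ≤ classSize f j) ∧ ∃ i, s + d ≤ classSize f i := by
    rw [hcopies] at hpos
    obtain ⟨⟨S, hS⟩⟩ := (Nat.card_pos_iff.1 hpos).1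
    exact hS.1.le_classSize (Nat.le_add_right s d)
  have hadj : ∀ v w, G.Adj v w ↔ f v ≠ f w := fun v w => by
    refine ⟨hf v w, fun hvw => ?_⟩
    by_contra hnadj
    obtain ⟨S, hTS, hS⟩ := exists_isPlacement_superset hs ht f hsize hi₀ {v, w} fun j => by
      refine Finset.card_le_one.2 fun a ha b hb => ?_
      simp only [Finset.mem_filter, Finset.mem_insert, Finset.mem_singleton] at ha hb
      obtain ⟨rfl | rfl, rfl⟩ := ha <;> obtain ⟨rfl | rfl, h⟩ := hb
      · rfl
      · exact absurd h.symm hvw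
      · exact absurd h hvw
      · rfl
    refine absurd (hmax' f) (not_le.2 ?_)
    rw [hcopies, Nat.card_eq_fintype_card, Nat.card_eq_fintype_card, Fintype.card_subtype,
      Fintype.card_subtype]
    refine Finset.card_lt_card (Finset.ssubset_iff_of_subset
      (Finset.monotone_filter_right _ fun S _ h => h.1) |>.2 ⟨S, by simpa using hS, fun h => ?_⟩)
    simp only [Finset.mem_filter, Finset.mem_univ, true_and] at h
    exact hnadj (h.2 v (hTS (by simp)) w (hTS (by simp)) hvw)
  have hG' : G = multipartiteOf f := by
    ext v w; rw [hadj, multipartiteOf_adj]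
  refine ⟨f, hadj, hsize, fun i j hij => ?_⟩
  by_contra hgain
  rw [not_le] at hgain
  obtain ⟨v, hv⟩ : ∃ v, f v = i := by
    have : 0 < classSize f i := by omega
    obtain ⟨v, hv⟩ := Finset.card_pos.1 this
    exact ⟨v, by simpa using hv⟩
  have hne : j ≠ i := by rintro rfl; omega
  have hlt := placements_lt_of_move s d hsize (m' := classSize (Function.update f v j)) hij ?_ ?_ ?_
    hgain
  · rw [← card_isPlacement_mul hr, ← card_isPlacement_mul hr] at hlt
    have h1 := hmax' (Function.update f v j)
    rw [hG', copies_multipartiteOf hr hs ht] at h1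
    exact absurd hlt (not_lt.2 (Nat.mul_le_mul_right _ h1))
  · have : (Finset.univ.filter fun x => f x = i)
        = insert v (Finset.univ.filter fun x => Function.update f v j x = i) := by
      ext x
      by_cases hx : x = v
      · subst hx; simp [hv]
      · simp [hx]
    rw [classSize, classSize, this, Finset.card_insert_of_notMem (by simp [hne])]
  · have : (Finset.univ.filter fun x => Function.update f v j x = j)
        = insert v (Finset.univ.filter fun x => f x = j) := by
      ext x
      by_cases hx : x = v
      · subst hx; simp
      · simp [hx]
    rw [classSize, classSize, this, Finset.card_insert_of_notMem (by simp [hv, hne.symm])]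
  · intro k hki hkj
    rw [classSize, classSize]
    congr 1
    ext x
    by_cases hx : x = v
    · subst hx; simp [hv, hki.symm, hkj.symm]
    · simp [hx]

lemma nonempty_iso_turanGraph {n r : ℕ} {G : SimpleGraph (Fin n)} {f : Fin n → Fin r}
    (hadj : ∀ v w, G.Adj v w ↔ f v ≠ f w) (hpos : ∀ j, 0 < classSize f j)
    (hbal : ∀ i j, classSize f i ≤ classSize f j + 1) : Nonempty (G ≃g turanGraph n r) := by
  classical
  let P : Finpartition (Finset.univ : Finset (Fin n)) := Finpartition.ofSetoid (Setoid.ker f)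
  have hex : ∀ j, ∃ v, f v = j := fun j => by
    obtain ⟨v, hv⟩ := Finset.card_pos.1 (hpos j)
    exact ⟨v, by simpa using hv⟩
  have hparts : P.parts = Finset.univ.image fun j => Finset.univ.filter fun v => f v = j := by
    ext A
    simp only [P, Finpartition.ofSetoid, Finset.mem_image, Finset.mem_univ, true_and,
      Finpartition.ofSetSetoid, Setoid.ker_def]
    constructor
    · rintro ⟨v, rfl⟩
      exact ⟨f v, by ext w; simp [eq_comm]⟩
    · rintro ⟨j, rfl⟩
      obtain ⟨v, rfl⟩ := hex j
      exact ⟨v, by ext w; simp [eq_comm]⟩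
  have hcard : P.parts.card = r := by
    rw [hparts, Finset.card_image_of_injective, Finset.card_univ, Fintype.card_fin]
    intro i j hij
    obtain ⟨v, rfl⟩ := hex i
    have : v ∈ Finset.univ.filter fun w => f w = j := by
      have h : (Finset.univ.filter fun w => f w = f v) = Finset.univ.filter fun w => f w = j := hij
      rw [← h]; simp
    simpa using this
  have hequi : P.IsEquipartition := by
    intro A B hA hB
    simp only [hparts, Finset.coe_image, Set.mem_image] at hA hB
    obtain ⟨i, -, rfl⟩ := hA
    obtain ⟨j, -, rfl⟩ := hB
    exact hbal i j
  obtain ⟨e, he⟩ := hequi.exists_partPreservingEquiv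
  rw [hcard] at he
  have hpart : ∀ v w, P.part v = P.part w ↔ f v = f w := fun v w => by
    rw [← P.mem_part_iff_part_eq_part (Finset.mem_univ v) (Finset.mem_univ w),
      Finpartition.mem_part_ofSetoid_iff_rel, Setoid.ker_def, eq_comm]
  refine ⟨⟨(Equiv.subtypeUnivEquiv Finset.mem_univ).symm.trans
    (e.trans (finCongr (by simp))), fun {v w} => ?_⟩⟩
  have := he ⟨v, Finset.mem_univ v⟩ ⟨w, Finset.mem_univ w⟩
  rw [hadj, turanGraph_adj, ne_eq, ne_eq, ← hpart, this]
  rfl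

lemma le_of_sub_half_le_sqrt (s d : ℕ) (h : ((s + d : ℕ) : ℝ) ≤ s + 1 / 2 + √(2 * s + 1 / 4)) :
    (d : ℝ) * (d - 1) ≤ 2 * s := by
  rcases d with _ | d
  · simp
  have h1 : (d : ℝ) + 1 / 2 ≤ √(2 * s + 1 / 4) := by push_cast at h; linarith
  rw [Real.le_sqrt (by positivity) (by positivity)] at h1
  push_cast
  linarith

lemma lt_of_sub_half_lt_sqrt (s d : ℕ) (hs : 1 ≤ s)
    (h : ((s + d : ℕ) : ℝ) < s + 1 / 2 + √(2 * s + 1 / 4)) :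
    (d : ℝ) * (d - 1) < 2 * s := by
  have hs' : (1 : ℝ) ≤ s := by exact_mod_cast hs
  rcases d with _ | d
  · simp; linarith
  have h1 : (d : ℝ) + 1 / 2 < √(2 * s + 1 / 4) := by push_cast at h; linarith
  rw [Real.lt_sqrt (by positivity)] at h1
  push_cast
  linarith

theorem statement15 (r s t : ℕ) (hr : 2 ≤ r) (hs : 1 ≤ s) (hst : s ≤ t)
    (ht : (t : ℝ) ≤ s + 1 / 2 + Real.sqrt (2 * s + 1 / 4)) :
    (∀ ε : ℝ, 0 < ε → ∃ n₀ : ℕ, ∀ n ≥ n₀, ∀ G : SimpleGraph (Fin n),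
      IsMultipartite r G →
      (∀ G' : SimpleGraph (Fin n), IsMultipartite r G' →
        copies (Kmulti r s t) G' ≤ copies (Kmulti r s t) G) →
      ∃ f : Fin n → Fin r,
        (∀ v w, v ≠ w → (G.Adj v w ↔ f v ≠ f w)) ∧
        ∀ i : Fin r,
          (1 / (r : ℝ) - ε) * n ≤ (Set.ncard {v | f v = i} : ℝ) ∧
          (Set.ncard {v | f v = i} : ℝ) ≤ (1 / (r : ℝ) + ε) * n) ∧
    ((t : ℝ) < s + 1 / 2 + Real.sqrt (2 * s + 1 / 4) →
      ∃ n₁ : ℕ, ∀ n ≥ n₁, ∀ G : SimpleGraph (Fin n),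
        IsMultipartite r G →
        (∀ G' : SimpleGraph (Fin n), IsMultipartite r G' →
          copies (Kmulti r s t) G' ≤ copies (Kmulti r s t) G) →
        Nonempty (G ≃g turanGraph n r)) := by
  obtain ⟨d, rfl⟩ := Nat.exists_eq_add_of_le hst
  have hr0 : 0 < r := by omega
  have hrR : (0 : ℝ) < r := by exact_mod_cast hr0
  have hle : ∀ {n : ℕ} (f : Fin n → Fin r) (i : Fin r), (classSize f i : ℝ) ≤ n := fun f i => by
    classical
    have := Finset.card_le_univ (Finset.univ.filter fun v => f v = i)
    rw [Fintype.card_fin] at this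
    rw [classSize]
    exact_mod_cast this
  have hsum : ∀ {n : ℕ} (f : Fin n → Fin r), ∑ j, (classSize f j : ℝ) = n := fun f => by
    have := sum_classSize f
    rw [Fintype.card_fin] at this
    exact_mod_cast this
  refine ⟨fun ε hε => ?_, fun hlt => ?_⟩
  · obtain ⟨N₀, hN₀⟩ := moveGain_pos_of_linear_gap s d hs (le_of_sub_half_le_sqrt s d ht)
      (half_pos hε)
    refine ⟨r * (s + d) + ⌈N₀⌉₊ + ⌈2 / ε⌉₊, fun n hn G hG hmax => ?_⟩
    obtain ⟨f, hadj, hsize, hgain⟩ := exists_coloring_of_maximizer hr0 hs (by omega) hG hmax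
    have hn1 : N₀ ≤ n := (Nat.le_ceil _).trans (by exact_mod_cast (by omega : ⌈N₀⌉₊ ≤ n))
    have hn2 : 2 / ε ≤ n := (Nat.le_ceil _).trans (by exact_mod_cast (by omega : ⌈2 / ε⌉₊ ≤ n))
    have hn3 : 2 ≤ ε * n := by rwa [div_le_iff₀' hε] at hn2
    have hgap : ∀ i j, (classSize f i : ℝ) - classSize f j ≤ ε * n := fun i j => by
      by_contra! h
      have h1 : classSize f j + 2 ≤ classSize f i := by
        have : (classSize f j : ℝ) + 2 ≤ classSize f i := by linarith
        exact_mod_cast this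
      have h2 : (s : ℝ) ≤ classSize f j := by exact_mod_cast hsize j
      have h3 := hle f i
      exact absurd (hgain i j h1) (not_le.2
        (hN₀ n _ _ hn1 (by linarith) (by linarith) (by linarith) (by linarith)))
    refine ⟨f, fun v w _ => hadj v w, fun i => ?_⟩
    have hcard : (Set.ncard {v | f v = i} : ℝ) = classSize f i := by
      classical
      rw [classSize, Set.ncard_eq_toFinset_card']
      simp
    rw [hcard]
    have h1 : (r : ℝ) * classSize f i ≤ n + r * (ε * n) := by
      have := Finset.sum_le_sum fun j (_ : j ∈ Finset.univ) => hgap i j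
      simp only [Finset.sum_sub_distrib, hsum, Finset.sum_const, Finset.card_univ,
        Fintype.card_fin, nsmul_eq_mul] at this
      linarith
    have h2 : (n : ℝ) - r * classSize f i ≤ r * (ε * n) := by
      have := Finset.sum_le_sum fun j (_ : j ∈ Finset.univ) => hgap j i
      simpa only [Finset.sum_sub_distrib, hsum, Finset.sum_const, Finset.card_univ,
        Fintype.card_fin, nsmul_eq_mul] using this
    constructor
    · refine le_of_mul_le_mul_left ?_ hrR
      calc (r : ℝ) * ((1 / r - ε) * n) = n - r * (ε * n) := by field_simp
        _ ≤ _ := by linarith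
    · refine le_of_mul_le_mul_left ?_ hrR
      calc _ ≤ n + r * (ε * n) := h1
        _ = (r : ℝ) * ((1 / r + ε) * n) := by field_simp
  · obtain ⟨N₀, hN₀⟩ := moveGain_pos_of_linear_max s d (lt_of_sub_half_lt_sqrt s d hs hlt)
      (by positivity : (0 : ℝ) < 1 / (2 * r))
    refine ⟨r * (s + d) + ⌈N₀⌉₊ + 2 * r * s, fun n hn G hG hmax => ?_⟩
    obtain ⟨f, hadj, hsize, hgain⟩ := exists_coloring_of_maximizer hr0 hs (by omega) hG hmax
    have hn1 : N₀ ≤ n := (Nat.le_ceil _).trans (by exact_mod_cast (by omega : ⌈N₀⌉₊ ≤ n))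
    have hn2 : (2 : ℝ) * r * s ≤ n := by exact_mod_cast (by omega : 2 * r * s ≤ n)
    refine nonempty_iso_turanGraph hadj (fun j => hs.trans (hsize j)) ?_
    have : Nonempty (Fin r) := ⟨⟨0, hr0⟩⟩
    obtain ⟨i, hi⟩ := Finite.exists_max (classSize f)
    obtain ⟨j, hj⟩ := Finite.exists_min (classSize f)
    suffices h : classSize f i ≤ classSize f j + 1 from
      fun a b => (hi a).trans (h.trans (Nat.add_le_add_right (hj b) 1))
    by_contra! h
    have h1 : (s : ℝ) ≤ classSize f j := by exact_mod_cast hsize j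
    have h2 : (classSize f j : ℝ) + 2 ≤ classSize f i := by exact_mod_cast h
    have h3 : (n : ℝ) ≤ r * classSize f i := by
      have := Finset.sum_le_sum fun k (_ : k ∈ Finset.univ) =>
        (Nat.cast_le (α := ℝ)).2 (hi k)
      simpa only [hsum, Finset.sum_const, Finset.card_univ, Fintype.card_fin,
        nsmul_eq_mul] using this
    have h4 : 1 / (2 * (r : ℝ)) * n ≤ classSize f i - s := by
      rw [one_div_mul_eq_div, div_le_iff₀ (by positivity)]
      linarith
    have h5 := hle f i
    exact absurd (hgain i j h) (not_le.2
      (hN₀ n _ _ hn1 (by linarith) (by linarith) (by linarith) h4))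
end

section
/- Let r ≥ 2 and t ≥ s ≥ 1 be integers with t ≤ s + 1/2 + √(2s + 1/4), and let γ, ε > 0 satisfy γ + ε < (r−1)/r. Then: (i) if t < s + 1/2 + √(2s + 1/4), there exists n₀ such that for all n ≥ n₀ and all integers a with γn ≤ a ≤ ⌊(r−1)n/r⌋, one has F_{r,s,t}(a+1, n) > F_{r,s,t}(a, n); (ii) if t = s + 1/2 + √(2s + 1/4), there exists n₀ such that for all n ≥ n₀ and all integers a with γn ≤ a ≤ ((r−1)/r − ε)n, one has F_{r,s,t}(a+1, n) > F_{r,s,t}(a, n). -/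
open SimpleGraph

section Counting

variable {k : ℕ}

/-- The part sizes of a complete multipartite graph whose `i`-th part has size `t` and whose other
parts have size `s`. -/
def partSizes (s t : ℕ) (i j : Fin k) : ℕ := if j = i then t else s

variable {V : Type*} {G : SimpleGraph V} {c : V → Fin k}

theorem iso_Kmulti_of_partSizes [Finite V] [NeZero k] {s t : ℕ}
    (H : G.Subgraph) (hH : ∀ v w, H.Adj v w ↔ v ∈ H.verts ∧ w ∈ H.verts ∧ c v ≠ c w) (i : Fin k)
    (hi : ∀ j, Nat.card {v : H.verts // c v = j} = partSizes s t i j) :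
    Nonempty (H.coe ≃g Kmulti k s t) := by
  let σ : Equiv.Perm (Fin k) := Equiv.swap 0 i
  have hcard : ∀ j, Nat.card {v : H.verts // σ (c v) = j} = if (j : ℕ) = 0 then t else s := by
    intro j
    have h1 : ∀ v : H.verts, σ (c v) = j ↔ c v = σ j := fun v => by
      rw [← Equiv.eq_symm_apply]; simp [σ]
    have h2 : (j : ℕ) = 0 ↔ σ j = i := by
      rw [← Equiv.eq_symm_apply, Fin.val_eq_zero_iff]
      simp [σ]
    simp_rw [h1, hi, partSizes, h2]
  let e : (Σ j, {v : H.verts // σ (c v) = j}) ≃ Σ j : Fin k, Fin (if (j : ℕ) = 0 then t else s) :=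
    Equiv.sigmaCongrRight fun j => Finite.equivFinOfCardEq (hcard j)
  refine ⟨⟨(Equiv.sigmaFiberEquiv fun v : H.verts => σ (c v)).symm.trans e, ?_⟩⟩
  intro v w
  change σ (c v) ≠ σ (c w) ↔ H.Adj v w
  simp [hH]

theorem adj_and_partSizes_of_iso_Kmulti (hG : ∀ v w, G.Adj v w ↔ c v ≠ c w) [NeZero k] {s t : ℕ}
    (hs : 1 ≤ s) (ht : 1 ≤ t) (H : G.Subgraph) (φ : H.coe ≃g Kmulti k s t) :
    (∀ v w, H.Adj v w ↔ v ∈ H.verts ∧ w ∈ H.verts ∧ c v ≠ c w) ∧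
      ∃ i, ∀ j, Nat.card {v : H.verts // c v = j} = partSizes s t i j := by
  have hpos : ∀ j : Fin k, 0 < if (j : ℕ) = 0 then t else s := fun j => by split_ifs <;> omega
  have hne : ∀ x y : Σ j : Fin k, Fin (if (j : ℕ) = 0 then t else s), x.1 ≠ y.1 →
      c (φ.symm x) ≠ c (φ.symm y) := fun x y hxy =>
    (hG _ _).1 (H.adj_sub (φ.symm.map_adj_iff.2 (show (Kmulti k s t).Adj x y from hxy)))
  let τ : Fin k → Fin k := fun j => c (φ.symm ⟨j, 0, hpos j⟩)
  have hτ : Function.Bijective τ := by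
    refine Finite.injective_iff_bijective.1 fun i j hij => ?_
    by_contra h
    exact hne _ _ h hij
  have hcol : ∀ x, c (φ.symm x) = τ x.1 := by
    intro x
    obtain ⟨j, hj⟩ := hτ.2 (c (φ.symm x))
    by_cases h : x.1 = j
    · rw [h, hj]
    · exact absurd hj.symm (hne x ⟨j, 0, hpos j⟩ h)
  have hcol' : ∀ v : H.verts, c v = τ (φ v).1 := fun v => by
    rw [← hcol, RelIso.symm_apply_apply]
  refine ⟨fun v w => ⟨fun h => ⟨H.edge_vert h, H.edge_vert h.symm, (hG _ _).1 (H.adj_sub h)⟩, ?_⟩,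
    τ 0, ?_⟩
  · rintro ⟨hv, hw, h⟩
    have h' : (φ ⟨v, hv⟩).1 ≠ (φ ⟨w, hw⟩).1 := fun h' => h (by
      rw [hcol' ⟨v, hv⟩, hcol' ⟨w, hw⟩, h'])
    exact φ.map_adj_iff.1 (show (Kmulti k s t).Adj _ _ from h')
  · intro j
    obtain ⟨i, rfl⟩ := hτ.2 j
    have e : {v : H.verts // c v = τ i} ≃
        {x : Σ j : Fin k, Fin (if (j : ℕ) = 0 then t else s) // x.1 = i} :=
      φ.toEquiv.subtypeEquiv fun v => by
        rw [hcol' v, hτ.1.eq_iff]; rfl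
    rw [Nat.card_congr (e.trans (Equiv.sigmaSubtype i)), Nat.card_fin, partSizes]
    simp [hτ.1.eq_iff, Fin.val_eq_zero_iff]

theorem copies_Kmulti_eq_card [Fintype V] [DecidableEq V] [NeZero k]
    (hG : ∀ v w, G.Adj v w ↔ c v ≠ c w) {s t : ℕ} (hs : 1 ≤ s) (ht : 1 ≤ t) :
    copies (Kmulti k s t) G =
      (Finset.univ.filter fun S : Finset V =>
        ∃ i, ∀ j, (S.filter fun v => c v = j).card = partSizes s t i j).card := by
  classical
  have hcard : ∀ (A : Set V) (j : Fin k),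
      Nat.card {v : A // c v = j} = (A.toFinset.filter fun v => c v = j).card := by
    intro A j
    rw [← Nat.card_eq_finsetCard]
    exact Nat.card_congr ((Equiv.subtypeSubtypeEquivSubtypeInter (· ∈ A) (c · = j)).trans
      (Equiv.subtypeEquivRight fun v => by simp))
  have key : ∀ H : G.Subgraph, Nonempty (H.coe ≃g Kmulti k s t) →
      (∀ v w, H.Adj v w ↔ v ∈ H.verts ∧ w ∈ H.verts ∧ c v ≠ c w) ∧
        ∃ i, ∀ j, (H.verts.toFinset.filter fun v => c v = j).card = partSizes s t i j := by
    rintro H ⟨φ⟩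
    simp_rw [← hcard]
    exact adj_and_partSizes_of_iso_Kmulti hG hs ht H φ
  rw [copies, ← Nat.card_eq_finsetCard]
  refine Nat.card_eq_of_bijective
    (fun H => ⟨H.1.verts.toFinset, by simpa using (key H.1 H.2).2⟩) ⟨?_, ?_⟩
  · rintro ⟨H, hH⟩ ⟨H', hH'⟩ h
    have hv : H.verts = H'.verts := by simpa using h
    refine Subtype.ext (SimpleGraph.Subgraph.ext hv ?_)
    ext v w
    rw [(key H hH).1, (key H' hH').1, hv]
  · rintro ⟨S, hS⟩
    obtain ⟨i, hi⟩ := (Finset.mem_filter.1 hS).2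
    refine ⟨⟨(⊤ : G.Subgraph).induce S, iso_Kmulti_of_partSizes (c := c) _ (fun v w => ?_) i
      fun j => ?_⟩, ?_⟩
    · simp [hG]
    · rw [hcard, ← hi]
      congr 1
      ext v
      simp
    · simp

theorem filter_biUnion_of_subset_fibers [Fintype V] [DecidableEq V] {T : Fin k → Finset V}
    (hT : ∀ j, T j ⊆ Finset.univ.filter fun v => c v = j) (j : Fin k) :
    ((Finset.univ.biUnion T).filter fun v => c v = j) = T j := by
  ext v
  simp only [Finset.mem_filter, Finset.mem_biUnion, Finset.mem_univ, true_and]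
  constructor
  · rintro ⟨⟨i, hi⟩, rfl⟩
    rwa [(Finset.mem_filter.1 (hT i hi)).2]
  · exact fun h => ⟨⟨j, h⟩, (Finset.mem_filter.1 (hT j h)).2⟩

theorem card_filter_partSizes [Fintype V] [DecidableEq V] (f : Fin k → ℕ) :
    (Finset.univ.filter fun S : Finset V => ∀ j, (S.filter fun v => c v = j).card = f j).card =
      ∏ j, ((Finset.univ.filter fun v => c v = j).card).choose (f j) := by
  simp_rw [← Finset.card_powersetCard]
  rw [← Fintype.card_piFinset]
  refine Finset.card_bij' (fun S _ j => S.filter fun v => c v = j)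
    (fun T _ => Finset.univ.biUnion T) ?_ ?_ ?_ ?_
  · intro S hS
    simp only [Finset.mem_filter, Finset.mem_univ, true_and] at hS
    simp only [Fintype.mem_piFinset, Finset.mem_powersetCard]
    exact fun j => ⟨Finset.filter_subset_filter _ (Finset.subset_univ _), hS j⟩
  · intro T hT
    simp only [Fintype.mem_piFinset, Finset.mem_powersetCard] at hT
    simp only [Finset.mem_filter, Finset.mem_univ, true_and]
    exact fun j => by rw [filter_biUnion_of_subset_fibers fun i => (hT i).1, (hT j).2]
  · intro S _
    ext v
    simp
  · intro T hT
    simp only [Fintype.mem_piFinset, Finset.mem_powersetCard] at hT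
    exact funext fun j => filter_biUnion_of_subset_fibers (fun i => (hT i).1) j

theorem copies_Kmulti_self [Fintype V] [DecidableEq V] [NeZero k]
    (hG : ∀ v w, G.Adj v w ↔ c v ≠ c w) {s : ℕ} (hs : 1 ≤ s) :
    copies (Kmulti k s s) G = ∏ j, ((Finset.univ.filter fun v => c v = j).card).choose s := by
  rw [copies_Kmulti_eq_card hG hs hs, ← card_filter_partSizes]
  simp [partSizes]

theorem copies_Kmulti_of_ne [Fintype V] [DecidableEq V] [NeZero k]
    (hG : ∀ v w, G.Adj v w ↔ c v ≠ c w) {s t : ℕ} (hs : 1 ≤ s) (ht : 1 ≤ t) (hst : s ≠ t) :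
    copies (Kmulti k s t) G =
      ∑ i, ∏ j, ((Finset.univ.filter fun v => c v = j).card).choose (partSizes s t i j) := by
  simp_rw [copies_Kmulti_eq_card hG hs ht, ← card_filter_partSizes]
  rw [← Finset.card_biUnion]
  · congr 1
    ext S
    simp
  · intro i _ i' _ hi
    rw [Function.onFun, Finset.disjoint_left]
    intro S hS hS'
    simp only [Finset.mem_filter, Finset.mem_univ, true_and] at hS hS'
    have h := (hS i).symm.trans (hS' i)
    simp only [partSizes, if_pos, if_neg hi] at h
    exact hst h.symm

end Counting
section Asymptotics

open Filter Topology

/-- `X` is asymptotic to `x * n ^ e` along `l`, and `X' - X` to `x * ρ * n ^ (e - 1)`. -/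
def HasIncrement (l : Filter ℕ) (X X' : ℕ → ℝ) (e : ℕ) (x ρ : ℝ) : Prop :=
  Tendsto (fun n => X n / (n : ℝ) ^ e) l (𝓝 x) ∧
    Tendsto (fun n => n * (X' n - X n) / (n : ℝ) ^ e) l (𝓝 (x * ρ))

namespace HasIncrement

variable {l : Filter ℕ} {X X' Y Y' : ℕ → ℝ} {e f : ℕ} {x y ρ σ : ℝ}

theorem tendsto_succ (hl : l ≤ atTop) (hX : HasIncrement l X X' e x ρ) :
    Tendsto (fun n => X' n / (n : ℝ) ^ e) l (𝓝 x) := by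
  have h := hX.1.add ((tendsto_natCast_atTop_atTop.mono_left hl).inv_tendsto_atTop.mul hX.2)
  rw [zero_mul, add_zero] at h
  refine h.congr' ?_
  filter_upwards [hl (eventually_ne_atTop 0)] with n hn
  have : (n : ℝ) ≠ 0 := by exact_mod_cast hn
  simp only [Pi.inv_apply]
  field_simp
  ring

theorem mul (hl : l ≤ atTop) (hX : HasIncrement l X X' e x ρ) (hY : HasIncrement l Y Y' f y σ) :
    HasIncrement l (fun n => X n * Y n) (fun n => X' n * Y' n) (e + f) (x * y) (ρ + σ) := by
  constructor
  · refine (hX.1.mul hY.1).congr fun n => ?_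
    rw [pow_add, div_mul_div_comm]
  · have h := (hX.2.mul (hY.tendsto_succ hl)).add (hX.1.mul hY.2)
    rw [show x * y * (ρ + σ) = x * ρ * y + x * (y * σ) by ring]
    refine h.congr fun n => ?_
    rw [pow_add, div_mul_div_comm, div_mul_div_comm, ← add_div]
    congr 1
    ring

theorem const (x : ℝ) : HasIncrement l (fun _ => x) (fun _ => x) 0 x 0 := by
  simp [HasIncrement, tendsto_const_nhds]

theorem prod (hl : l ≤ atTop) {ι : Type*} (s : Finset ι) {X X' : ι → ℕ → ℝ} {e : ι → ℕ}
    {x ρ : ι → ℝ} (h : ∀ i ∈ s, HasIncrement l (X i) (X' i) (e i) (x i) (ρ i)) :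
    HasIncrement l (fun n => ∏ i ∈ s, X i n) (fun n => ∏ i ∈ s, X' i n) (∑ i ∈ s, e i)
      (∏ i ∈ s, x i) (∑ i ∈ s, ρ i) := by
  classical
  induction s using Finset.induction_on with
  | empty => simpa using const 1
  | insert i s hi ih =>
    simp only [Finset.prod_insert hi, Finset.sum_insert hi]
    exact (h i (Finset.mem_insert_self _ _)).mul hl
      (ih fun j hj => h j (Finset.mem_insert_of_mem hj))

/-- A sequence of linear growth stepping by `δ`. -/
theorem of_sub_eq (hX : Tendsto (fun n => X n / (n : ℝ)) l (𝓝 x)) (hx : x ≠ 0) {δ : ℝ}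
    (hl : l ≤ atTop) (h : ∀ᶠ n in l, X' n - X n = δ) : HasIncrement l X X' 1 x (δ / x) := by
  refine ⟨by simpa using hX, tendsto_const_nhds.congr' ?_⟩
  filter_upwards [h, hl (eventually_ne_atTop 0)] with n hn hn0
  have : (n : ℝ) ≠ 0 := by exact_mod_cast hn0
  rw [hn]
  field_simp

theorem sub_const (hl : l ≤ atTop) (hX : HasIncrement l X X' 1 x ρ) (a : ℝ) :
    HasIncrement l (fun n => X n - a) (fun n => X' n - a) 1 x ρ := by
  constructor
  · have h := hX.1.sub
      ((tendsto_const_nhds (x := a)).div_atTop (tendsto_natCast_atTop_atTop.mono_left hl))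
    rw [sub_zero] at h
    exact h.congr fun n => by rw [pow_one, sub_div]
  · simpa using hX.2

theorem choose (hl : l ≤ atTop) {w w' : ℕ → ℕ} (h : HasIncrement l (w ·) (w' ·) 1 x ρ) (j : ℕ) :
    HasIncrement l (fun n => ((w n).choose j : ℝ)) (fun n => ((w' n).choose j : ℝ)) j
      (x ^ j / j.factorial) (j * ρ) := by
  have hsucc : ∀ m i : ℕ, (m.choose (i + 1) : ℝ) = ((i : ℝ) + 1)⁻¹ * (m.choose i * (m - i)) := by
    intro m i
    rw [eq_inv_mul_iff_mul_eq₀ (by positivity)]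
    rcases le_or_gt i m with him | him
    · rw [← Nat.cast_sub him]
      exact_mod_cast (mul_comm _ _).trans (Nat.choose_succ_right_eq m i)
    · simp [Nat.choose_eq_zero_of_lt him, Nat.choose_eq_zero_of_lt (him.trans i.lt_succ_self)]
  induction j with
  | zero => simpa using const 1
  | succ i ih =>
    have := (const ((i : ℝ) + 1)⁻¹).mul hl (ih.mul hl (h.sub_const hl i))
    simp_rw [hsucc]
    convert this using 1
    · ring
    · rw [Nat.factorial_succ]
      push_cast
      field_simp
      ring
    · push_cast
      ring

end HasIncrement

end Asymptotics

theorem one_add_pow_mul_add_pos {y : ℝ} (hy : 0 < y) (d : ℕ) :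
    0 < (1 + y) ^ d * ((d + 1) * y - 1) + 1 := by
  induction d with
  | zero => simpa using hy
  | succ d ih =>
    have : 0 < (1 + y) ^ d * ((d + 2) * y ^ 2) := by positivity
    rw [pow_succ]
    push_cast
    nlinarith

theorem one_add_pow_mul_sub_add_pos {y : ℝ} (hy : 0 < y) (d : ℕ) :
    0 < (1 + y) ^ (d + 1) * ((d + 1) * y - 2) + ((d + 1) * y + 2) := by
  induction d with
  | zero => norm_num; nlinarith
  | succ d ih =>
    have := mul_pos hy (one_add_pow_mul_add_pos hy (d + 1))
    rw [pow_succ _ (d + 1)]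
    push_cast at *
    nlinarith

theorem sub_one_mul_pow_sub_one_lt {s d : ℕ} (hs : 1 ≤ s) (hd : (d : ℝ) * (d - 1) ≤ 2 * s) {y : ℝ}
    (hy : 0 < y) : (d - 1) * ((1 + y) ^ d - 1) < s * y * (1 + (1 + y) ^ d) := by
  have hs' : (0 : ℝ) < s := by exact_mod_cast hs
  have hsy : 0 < s * y * (1 + (1 + y) ^ d) := by positivity
  rcases d with _ | _ | d
  · simpa using hsy
  · simpa using hsy
  · have h := mul_pos (show (0 : ℝ) < d + 1 by positivity) (one_add_pow_mul_sub_add_pos hy (d + 1))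
    have hq : 0 < y * (1 + (1 + y) ^ (d + 2)) := by positivity
    have h' := mul_le_mul_of_nonneg_right hd hq.le
    push_cast at *
    nlinarith

theorem weighted_increment_pos {k s d : ℕ} (hk : 1 ≤ k) (hs : 1 ≤ s) {u v : ℝ} (hu : 0 < u)
    (huv : u ≤ v) (hd : (d : ℝ) * (d - 1) ≤ 2 * s)
    (hstrict : u < v ∨ (d : ℝ) * (d - 1) < 2 * s) :
    0 < s * u ^ d * ((d + k * s) * v - k * (s - 1) * u) +
      (s + d : ℝ) * v ^ d * (s * v - (s + d - 1) * u) := by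
  obtain ⟨y, rfl⟩ : ∃ y, v = u * (1 + y) := ⟨v / u - 1, by field_simp; simp⟩
  have hs' : (1 : ℝ) ≤ s := by exact_mod_cast hs
  have hk' : (1 : ℝ) ≤ k := by exact_mod_cast hk
  have hy : 0 ≤ y := by nlinarith
  have hsd : (0 : ℝ) < s + d := by positivity
  have key : 0 < (s + d) * (s * y * (1 + (1 + y) ^ d) - (d - 1) * ((1 + y) ^ d - 1)) +
      (2 * s - d * (d - 1) : ℝ) := by
    rcases hy.eq_or_lt with rfl | hy
    · simpa using hstrict
    · have := mul_pos hsd (sub_pos.2 (sub_one_mul_pow_sub_one_lt hs hd hy))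
      linarith
  have hk1 : 0 ≤ (k - 1 : ℝ) * (s + s ^ 2 * y) := mul_nonneg (by linarith) (by positivity)
  have : 0 < u ^ (d + 1) := by positivity
  have := mul_pos this (add_pos_of_pos_of_nonneg key hk1)
  refine this.trans_eq ?_
  rw [mul_pow]
  ring

/-- The size of the `j`-th part of `turanGraph a k`. -/
def turanPart (k a : ℕ) (j : Fin k) : ℕ := a.count (· ≡ j [MOD k])

section TuranParts

variable {K : ℕ}

theorem turanPart_succ (a : ℕ) (j : Fin (K + 1)) :
    turanPart (K + 1) (a + 1) j =
      turanPart (K + 1) a j + if j = Fin.ofNat (K + 1) a then 1 else 0 := by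
  rw [turanPart, turanPart, Nat.count_succ]
  congr 2
  rw [Nat.ModEq, Fin.ext_iff, Fin.val_ofNat, Nat.mod_eq_of_lt j.2, eq_comm (a := a % (K + 1))]

theorem card_filter_ofNat_eq (a : ℕ) (j : Fin (K + 1)) :
    (Finset.univ.filter fun v : Fin a => Fin.ofNat (K + 1) v = j).card = turanPart (K + 1) a j := by
  rw [turanPart, Nat.count_eq_card_filter_range, ← Nat.Iio_eq_range, ← Fin.map_valEmbedding_univ,
    Finset.filter_map, Finset.card_map]
  congr 1
  ext v
  simp [Nat.ModEq, Fin.ext_iff, Nat.mod_eq_of_lt j.2]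

theorem turanGraph_adj_iff (a : ℕ) (v w : Fin a) :
    (turanGraph a (K + 1)).Adj v w ↔ Fin.ofNat (K + 1) v ≠ Fin.ofNat (K + 1) w := by
  simp [turanGraph, Fin.ext_iff]

theorem abs_turanPart_sub_le (a : ℕ) (j : Fin (K + 1)) :
    |(turanPart (K + 1) a j : ℝ) - a / (K + 1 : ℕ)| ≤ 1 := by
  have h := Nat.count_modEq_card a K.succ_pos j
  have h1 : ((a / (K + 1) : ℕ) : ℝ) ≤ a / (K + 1 : ℕ) := Nat.cast_div_le
  have h2 : (a : ℝ) / (K + 1 : ℕ) ≤ (a / (K + 1) : ℕ) + 1 := by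
    rw [div_le_iff₀ (by positivity)]
    exact_mod_cast (mul_comm (K + 1) _ ▸ Nat.lt_mul_div_succ a K.succ_pos).le
  rw [turanPart, h, abs_le]
  split_ifs <;> push_cast at * <;> constructor <;> linarith

theorem Fval_self (s a n : ℕ) (hs : 1 ≤ s) :
    Fval (K + 2) s s a n =
      ((n - 1 - a).choose (s - 1) : ℝ) * ∏ j, ((turanPart (K + 1) a j).choose s : ℝ) := by
  rw [Fval, if_pos rfl, show K + 2 - 1 = K + 1 from rfl,
    copies_Kmulti_self (turanGraph_adj_iff a) hs]
  simp_rw [card_filter_ofNat_eq]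
  push_cast
  ring

theorem Fval_of_ne (s t a n : ℕ) (hs : 1 ≤ s) (ht : 1 ≤ t) (hst : s ≠ t) :
    Fval (K + 2) s t a n =
      ∑ i, ((n - 1 - a).choose (s - 1) : ℝ) *
          ∏ j, ((turanPart (K + 1) a j).choose (partSizes s t i j) : ℝ) +
        ((n - 1 - a).choose (t - 1) : ℝ) * ∏ j, ((turanPart (K + 1) a j).choose s : ℝ) := by
  rw [Fval, if_neg hst, show K + 2 - 1 = K + 1 from rfl,
    copies_Kmulti_self (turanGraph_adj_iff a) hs,
    copies_Kmulti_of_ne (turanGraph_adj_iff a) hs ht hst]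
  simp_rw [card_filter_ofNat_eq]
  push_cast
  rw [one_mul, Finset.mul_sum]

theorem prod_partSizes {M : Type*} [CommMonoid M] (g : ℕ → M) (s t : ℕ) (i : Fin (K + 1)) :
    ∏ j, g (partSizes s t i j) = g t * g s ^ K := by
  simp [Fin.prod_univ_succAbove _ i, partSizes, Fin.succAbove_ne]

theorem sum_partSizes (s t : ℕ) (i : Fin (K + 1)) : ∑ j, partSizes s t i j = K * s + t := by
  simp [Fin.sum_univ_succAbove _ i, partSizes, Fin.succAbove_ne, add_comm]

theorem partSizes_comm (s t : ℕ) (i j : Fin (K + 1)) :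
    partSizes s t i j = partSizes s t j i := by
  simp only [partSizes, eq_comm]

end TuranParts

section Limits

open Filter Topology

variable {K : ℕ} {l : Filter ℕ} {a : ℕ → ℕ} {x : ℝ} {i₀ : Fin (K + 1)}

theorem hasIncrement_turanPart (hl : l ≤ atTop) (ha : Tendsto (fun n => (a n : ℝ) / n) l (𝓝 x))
    (hx : 0 < x) (hi : ∀ᶠ n in l, Fin.ofNat (K + 1) (a n) = i₀) (j : Fin (K + 1)) :
    HasIncrement l (fun n => (turanPart (K + 1) (a n) j : ℝ))
      (fun n => (turanPart (K + 1) (a n + 1) j : ℝ)) 1 (x / (K + 1 : ℕ))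
      ((if j = i₀ then 1 else 0) / (x / (K + 1 : ℕ))) := by
  refine HasIncrement.of_sub_eq ?_ (by positivity) hl ?_
  · have hinv : Tendsto (fun n : ℕ => (n : ℝ)⁻¹) l (𝓝 0) :=
      (tendsto_natCast_atTop_atTop.mono_left hl).inv_tendsto_atTop
    have h0 : Tendsto (fun n => ((turanPart (K + 1) (a n) j : ℝ) - a n / (K + 1 : ℕ)) * (n : ℝ)⁻¹)
        l (𝓝 0) := by
      refine squeeze_zero_norm (fun n => ?_) hinv
      rw [norm_mul, Real.norm_eq_abs, Real.norm_of_nonneg (by positivity)]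
      exact mul_le_of_le_one_left (by positivity) (abs_turanPart_sub_le _ _)
    have h := h0.add (ha.div_const ((K + 1 : ℕ) : ℝ))
    rw [zero_add] at h
    exact h.congr fun n => by ring
  · filter_upwards [hi] with n hn
    rw [turanPart_succ, hn]
    push_cast
    ring

theorem hasIncrement_outside (hl : l ≤ atTop) (ha : Tendsto (fun n => (a n : ℝ) / n) l (𝓝 x))
    (hx : x < 1) :
    HasIncrement l (fun n => ((n - 1 - a n : ℕ) : ℝ)) (fun n => ((n - 1 - (a n + 1) : ℕ) : ℝ)) 1
      (1 - x) (-1 / (1 - x)) := by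
  have hinv : Tendsto (fun n : ℕ => (n : ℝ)⁻¹) l (𝓝 0) :=
    (tendsto_natCast_atTop_atTop.mono_left hl).inv_tendsto_atTop
  have hlarge : ∀ᶠ n in l, a n + 2 ≤ n := by
    have h := ha.add (hinv.const_mul 2)
    rw [mul_zero, add_zero] at h
    filter_upwards [h.eventually_lt_const hx, hl (eventually_gt_atTop 0)] with n hn hn0
    have hn0' : (0 : ℝ) < n := by exact_mod_cast hn0
    rw [← div_eq_mul_inv, ← add_div, div_lt_one hn0'] at hn
    exact_mod_cast hn.le
  refine HasIncrement.of_sub_eq ?_ (by linarith) hl ?_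
  · have h := ((tendsto_const_nhds (x := (1 : ℝ))).sub hinv).sub ha
    rw [sub_zero] at h
    refine h.congr' ?_
    filter_upwards [hlarge, hl (eventually_gt_atTop 0)] with n hn hn0
    have hn0' : (0 : ℝ) < n := by exact_mod_cast hn0
    rw [Nat.cast_sub (by omega), Nat.cast_sub (by omega)]
    field_simp
    simp
  · filter_upwards [hlarge] with n hn
    rw [show n - 1 - a n = n - 1 - (a n + 1) + 1 by omega]
    push_cast
    ring

theorem eventually_lt_of_tendsto_increment {X X' : ℕ → ℝ} {e : ℕ} {L : ℝ} (hL : 0 < L)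
    (h : Tendsto (fun n => n * (X' n - X n) / (n : ℝ) ^ e) l (𝓝 L)) : ∀ᶠ n in l, X n < X' n := by
  filter_upwards [h.eventually_const_lt hL] with n hn
  by_contra! hle
  exact hn.not_ge (div_nonpos_of_nonpos_of_nonneg
    (mul_nonpos_of_nonneg_of_nonpos (by positivity) (by linarith)) (by positivity))

theorem hasIncrement_choose_mul_prod (hl : l ≤ atTop)
    (ha : Tendsto (fun n => (a n : ℝ) / n) l (𝓝 x)) (hx : 0 < x) (hx1 : x < 1)
    (hi : ∀ᶠ n in l, Fin.ofNat (K + 1) (a n) = i₀) (p s t : ℕ) (i : Fin (K + 1)) :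
    HasIncrement l
      (fun n => ((n - 1 - a n).choose p : ℝ) *
        ∏ j, ((turanPart (K + 1) (a n) j).choose (partSizes s t i j) : ℝ))
      (fun n => ((n - 1 - (a n + 1)).choose p : ℝ) *
        ∏ j, ((turanPart (K + 1) (a n + 1) j).choose (partSizes s t i j) : ℝ))
      (p + (K * s + t))
      ((1 - x) ^ p / p.factorial *
        ((x / (K + 1 : ℕ)) ^ (K * s + t) / (t.factorial * s.factorial ^ K)))
      (p * (-1 / (1 - x)) + partSizes s t i i₀ / (x / (K + 1 : ℕ))) := by
  have h := ((hasIncrement_outside hl ha hx1).choose hl p).mul hl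
    (HasIncrement.prod hl Finset.univ fun j _ =>
      (hasIncrement_turanPart hl ha hx hi j).choose hl (partSizes s t i j))
  convert h using 1
  · rw [sum_partSizes]
  · rw [Finset.prod_div_distrib, Finset.prod_pow_eq_pow_sum, sum_partSizes,
      prod_partSizes (fun q => (q.factorial : ℝ))]
  · simp [div_eq_mul_inv]

theorem eventually_Fval_lt {s d : ℕ} (hl : l ≤ atTop)
    (ha : Tendsto (fun n => (a n : ℝ) / n) l (𝓝 x)) (hx : 0 < x)
    (hi : ∀ᶠ n in l, Fin.ofNat (K + 1) (a n) = i₀) (hs : 1 ≤ s)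
    (hle : x / (K + 1 : ℕ) ≤ 1 - x) (hd : (d : ℝ) * (d - 1) ≤ 2 * s)
    (hstrict : x / (K + 1 : ℕ) < 1 - x ∨ (d : ℝ) * (d - 1) < 2 * s) :
    ∀ᶠ n in l, Fval (K + 2) s (s + d) (a n) n < Fval (K + 2) s (s + d) (a n + 1) n := by
  have hu : 0 < x / (K + 1 : ℕ) := by positivity
  have hv : 0 < 1 - x := hu.trans_le hle
  have H := hasIncrement_choose_mul_prod hl ha hx (by linarith) hi
  have hpart : ∀ j : Fin (K + 1), partSizes s s 0 j = s := fun j => ite_self _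
  have hpos := weighted_increment_pos K.succ_pos hs hu hle hd hstrict
  generalize x / (K + 1 : ℕ) = u at *
  generalize 1 - x = v at *
  obtain ⟨q, rfl⟩ : ∃ q, s = q + 1 := ⟨s - 1, by omega⟩
  rcases d.eq_zero_or_pos with rfl | hd0
  · simp_rw [add_zero, Fval_self _ _ _ hs]
    have h := (H q (q + 1) (q + 1) 0).2
    simp_rw [hpart] at h
    refine eventually_lt_of_tendsto_increment ?_ h
    refine mul_pos (by positivity) ?_
    have : 0 < ((q : ℝ) + 1) * v - q * u := by nlinarith
    have := div_pos this (mul_pos hu hv)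
    refine this.trans_eq ?_
    push_cast
    field_simp
    ring
  · simp_rw [Fval_of_ne _ _ _ _ hs (show 1 ≤ q + 1 + d by omega)
      (show q + 1 ≠ q + 1 + d by omega)]
    have hA := tendsto_finsetSum Finset.univ
      fun i (_ : i ∈ Finset.univ) => (H q (q + 1) (q + 1 + d) i).2
    have hB := (H (q + d) (q + 1) (q + 1) 0).2
    simp_rw [hpart] at hB
    have h := hA.add hB
    refine eventually_lt_of_tendsto_increment (e := q + (K * (q + 1) + (q + 1 + d))) ?_
      (h.congr fun n => ?_)
    · have hC : 0 < v ^ q * u ^ (K * (q + 1) + (q + 1)) / (u * v) /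
          ((q + 1).factorial * (q + 1 + d).factorial * (q + 1).factorial ^ K) := by positivity
      have := mul_pos hC hpos
      simp_rw [← Finset.mul_sum, Finset.sum_add_distrib, ← Finset.sum_div, partSizes_comm _ _ _ i₀,
        ← Nat.cast_sum, sum_partSizes, Finset.sum_const, Finset.card_univ, Fintype.card_fin,
        nsmul_eq_mul]
      refine this.trans_eq ?_
      rw [show q + 1 + d = q + d + 1 by ring, Nat.factorial_succ (q + d), Nat.factorial_succ q,
        show K * (q + 1) + (q + d + 1) = K * (q + 1) + (q + 1) + d by ring, pow_add u _ d,
        pow_add v q d]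
      push_cast
      field_simp
      ring
    · rw [show q + 1 + d - 1 = q + d by omega, show q + 1 - 1 = q from rfl,
        show q + d + (K * (q + 1) + (q + 1)) = q + (K * (q + 1) + (q + 1 + d)) by ring,
        ← Finset.sum_div, ← add_div, ← Finset.mul_sum, Finset.sum_sub_distrib]
      ring

theorem exists_forall_Fval_lt {s d : ℕ} (hs : 1 ≤ s) (hd : (d : ℝ) * (d - 1) ≤ 2 * s) {γ c : ℝ}
    (hγ : 0 < γ) (hc : c ≤ (K + 1) / (K + 2))
    (hstrict : c < (K + 1) / (K + 2) ∨ (d : ℝ) * (d - 1) < 2 * s) :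
    ∃ n₀ : ℕ, ∀ n ≥ n₀, ∀ a : ℕ, γ * n ≤ (a : ℝ) → (a : ℝ) ≤ c * n →
      Fval (K + 2) s (s + d) a n < Fval (K + 2) s (s + d) (a + 1) n := by
  by_contra! hcon
  set S : Set ℕ := {n | ∃ a : ℕ, γ * n ≤ (a : ℝ) ∧ (a : ℝ) ≤ c * n ∧
    Fval (K + 2) s (s + d) (a + 1) n ≤ Fval (K + 2) s (s + d) a n}
  have hfreq : ∃ᶠ n in atTop, n ∈ S := frequently_atTop.2 hcon
  choose! a ha using fun n (h : n ∈ S) => h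
  have := frequently_mem_iff_neBot.1 hfreq
  have hU := Ultrafilter.of_le (atTop ⊓ 𝓟 S)
  generalize Ultrafilter.of (atTop ⊓ 𝓟 S) = U at hU
  obtain ⟨hl, hP⟩ := le_inf_iff.1 hU
  have hev : ∀ᶠ n : ℕ in U, γ * n ≤ (a n : ℝ) ∧ (a n : ℝ) ≤ c * n ∧
      Fval (K + 2) s (s + d) (a n + 1) n ≤ Fval (K + 2) s (s + d) (a n) n := by
    filter_upwards [le_principal_iff.1 hP] with n hn using ha n hn
  have hmem : ∀ᶠ n in U, (a n : ℝ) / n ∈ Set.Icc γ c := by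
    filter_upwards [hev, hl (eventually_gt_atTop 0)] with n hn hn0
    have hn0' : (0 : ℝ) < n := by exact_mod_cast hn0
    exact ⟨(le_div_iff₀ hn0').2 hn.1, (div_le_iff₀ hn0').2 hn.2.1⟩
  obtain ⟨x, ⟨hγx, hxc⟩, hx⟩ := isCompact_Icc.ultrafilter_le_nhds
    (U.map fun n => (a n : ℝ) / n) (le_principal_iff.2 hmem)
  obtain ⟨i₀, hi₀⟩ := (U.map fun n => Fin.ofNat (K + 1) (a n)).eq_pure_of_finite
  have hi : ∀ᶠ n in U, Fin.ofNat (K + 1) (a n) = i₀ := by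
    have : {i₀} ∈ U.map fun n => Fin.ofNat (K + 1) (a n) := by
      rw [hi₀]
      exact Set.mem_singleton _
    exact this
  have hK : (0 : ℝ) < K + 1 := by positivity
  rw [le_div_iff₀ (by positivity)] at hc
  rw [lt_div_iff₀ (by positivity)] at hstrict
  have hlt := eventually_Fval_lt (s := s) (d := d) hl hx (hγ.trans_le hγx) hi hs
    (by push_cast; rw [div_le_iff₀ hK]; nlinarith) hd
    (hstrict.imp_left fun h => by push_cast; rw [div_lt_iff₀ hK]; nlinarith)
  obtain ⟨n, hn, hn'⟩ := (hev.and hlt).exists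
  exact hn.2.2.not_gt hn'

end Limits

theorem statement16 (r s t : ℕ) (hr : 2 ≤ r) (hs : 1 ≤ s) (hst : s ≤ t)
    (ht : (t : ℝ) ≤ s + 1 / 2 + Real.sqrt (2 * s + 1 / 4))
    (γ ε : ℝ) (hγ : 0 < γ) (hε : 0 < ε) (hγε : γ + ε < ((r : ℝ) - 1) / r) :
    ((t : ℝ) < s + 1 / 2 + Real.sqrt (2 * s + 1 / 4) →
      ∃ n₀ : ℕ, ∀ n ≥ n₀, ∀ a : ℕ,
        γ * n ≤ (a : ℝ) → a ≤ (r - 1) * n / r →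
        Fval r s t a n < Fval r s t (a + 1) n) ∧
    ((t : ℝ) = s + 1 / 2 + Real.sqrt (2 * s + 1 / 4) →
      ∃ n₀ : ℕ, ∀ n ≥ n₀, ∀ a : ℕ,
        γ * n ≤ (a : ℝ) → (a : ℝ) ≤ (((r : ℝ) - 1) / r - ε) * n →
        Fval r s t a n < Fval r s t (a + 1) n) := by
  obtain ⟨K, rfl⟩ : ∃ K, r = K + 2 := ⟨r - 2, by omega⟩
  obtain ⟨d, rfl⟩ : ∃ d, t = s + d := ⟨t - s, by omega⟩
  have hs' : (1 : ℝ) ≤ s := by exact_mod_cast hs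
  have hsq : Real.sqrt (2 * s + 1 / 4) ^ 2 = 2 * s + 1 / 4 := Real.sq_sqrt (by positivity)
  have hsqrt : 1 / 2 < Real.sqrt (2 * s + 1 / 4) := by
    rw [Real.lt_sqrt (by norm_num)]
    linarith
  have hd0 : (0 : ℝ) ≤ d := d.cast_nonneg
  push_cast at ht ⊢
  have hfrac : ((K : ℝ) + 2 - 1) / (K + 2) = (K + 1) / (K + 2) := by ring
  rw [hfrac]
  constructor
  · intro hlt
    have hd : (d : ℝ) * (d - 1) < 2 * s := by nlinarith
    obtain ⟨n₀, h⟩ := exists_forall_Fval_lt (K := K) hs hd.le hγ le_rfl (Or.inr hd)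
    refine ⟨n₀, fun n hn a ha ha' => h n hn a ha ?_⟩
    rw [Nat.le_div_iff_mul_le (by omega)] at ha'
    rw [div_mul_eq_mul_div, le_div_iff₀ (by positivity)]
    exact_mod_cast ha'
  · intro _
    have hd : (d : ℝ) * (d - 1) ≤ 2 * s := by nlinarith
    exact exists_forall_Fval_lt hs hd hγ (by linarith) (Or.inl (by linarith))
end
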